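/- arXiv:2310.20047 — 7 statements merged into one kernel-verified Lean document; each statement's English description precedes it below -/
import Mathlib

section
/- Let G be an infinite, connected, locally finite, non-amenable, vertex-transitive graph. Then there exists ε > 0 such that for all finite X ⊆ V(G), |X| ≥ |C_fin(X)| + ε·|hull_fin(X)|. Moreover, if G is d-regular and has expansion constant δ, one may take ε = δ/d. -/
open Set

/-- The set of edges of `G` with one endpoint in `A` and the other in `B`. -/
def edgesBetween {V : Type*} (G : SimpleGraph V) (A B : Set V) : Set (Sym2 V) :=
  {e | e ∈ G.edgeSet ∧ ∃ a ∈ A, ∃ b ∈ B, e = s(a, b)}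

/-- The finite connected components of the induced subgraph of `G` on `V \ X`. -/
def finComponents {V : Type*} (G : SimpleGraph V) (X : Set V) :
    Set ((G.induce Xᶜ).ConnectedComponent) :=
  {C | C.supp.Finite}

/-- `hull_fin(X) := X ∪ ⋃ C_fin(X)`. -/
def hullFin {V : Type*} (G : SimpleGraph V) (X : Set V) : Set V :=
  X ∪ Subtype.val '' (⋃ C ∈ finComponents G X, C.supp)

theorem neighborFinset_apply_iso {V : Type*} (G : SimpleGraph V) [G.LocallyFinite]
    (φ : G ≃g G) (v : V) :
    G.neighborFinset (φ v) = (G.neighborFinset v).map φ.toEquiv.toEmbedding := by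
  ext w
  obtain ⟨w, rfl⟩ := φ.surjective w
  rw [SimpleGraph.mem_neighborFinset, φ.map_adj_iff, ← SimpleGraph.mem_neighborFinset]
  exact (Finset.mem_map' φ.toEquiv.toEmbedding).symm

section CutCard

variable {V : Type*} [DecidableEq V] (G : SimpleGraph V) [G.LocallyFinite]

/-- The number of edges of `G` leaving the finite set `F`. -/
def cutCard (F : Finset V) : ℕ :=
  ∑ v ∈ F, (G.neighborFinset v \ F).card

theorem cutCard_eq_sum_ite {F W : Finset V} (h : F ⊆ W) :
    cutCard G F = ∑ v ∈ W, if v ∈ F then (G.neighborFinset v \ F).card else 0 := by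
  rw [← Finset.sum_filter, Finset.filter_mem_eq_inter, Finset.inter_eq_right.mpr h, cutCard]

theorem cutCard_inter_add_cutCard_union_le (A B : Finset V) :
    cutCard G (A ∩ B) + cutCard G (A ∪ B) ≤ cutCard G A + cutCard G B := by
  rw [cutCard_eq_sum_ite G (Finset.inter_subset_left.trans Finset.subset_union_left :
      A ∩ B ⊆ A ∪ B), cutCard_eq_sum_ite G (Finset.Subset.refl (A ∪ B)),
    cutCard_eq_sum_ite G (Finset.subset_union_left : A ⊆ A ∪ B),
    cutCard_eq_sum_ite G (Finset.subset_union_right : B ⊆ A ∪ B),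
    ← Finset.sum_add_distrib, ← Finset.sum_add_distrib]
  refine Finset.sum_le_sum fun v _ => ?_
  have hA : (G.neighborFinset v \ (A ∪ B)).card ≤ (G.neighborFinset v \ A).card :=
    Finset.card_le_card (Finset.sdiff_subset_sdiff le_rfl Finset.subset_union_left)
  have hB : (G.neighborFinset v \ (A ∪ B)).card ≤ (G.neighborFinset v \ B).card :=
    Finset.card_le_card (Finset.sdiff_subset_sdiff le_rfl Finset.subset_union_right)
  have hAB := Finset.card_union_add_card_inter (G.neighborFinset v \ A) (G.neighborFinset v \ B)
  rw [← Finset.sdiff_inter_distrib_right, ← Finset.sdiff_union_distrib] at hAB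
  by_cases h1 : v ∈ A <;> by_cases h2 : v ∈ B <;> simp [h1, h2] <;> omega

theorem card_neighborFinset_apply_iso_sdiff (φ : G ≃g G) (F : Finset V) (v : V) :
    (G.neighborFinset (φ v) \ F.map φ.toEquiv.toEmbedding).card =
      (G.neighborFinset v \ F).card := by
  rw [neighborFinset_apply_iso, ← Finset.map_sdiff, Finset.card_map]

theorem cutCard_map_iso (φ : G ≃g G) (F : Finset V) :
    cutCard G (F.map φ.toEquiv.toEmbedding) = cutCard G F := by
  rw [cutCard, Finset.sum_map]
  exact Finset.sum_congr rfl fun v _ => card_neighborFinset_apply_iso_sdiff G φ F v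

/-- Among the nonempty finite sets, one that minimizes the cut and then the cardinality is a block
of imprimitivity of the automorphism group. -/
theorem exists_minimal_cutCard_block [Nonempty V] :
    ∃ A : Finset V, A.Nonempty ∧ (∀ F : Finset V, F.Nonempty → cutCard G A ≤ cutCard G F) ∧
      ∀ φ : G ≃g G, (A ∩ A.map φ.toEquiv.toEmbedding).Nonempty →
        A.map φ.toEquiv.toEmbedding = A := by
  obtain ⟨A, hA, hmin⟩ := (InvImage.wf (fun F : Finset V => toLex (cutCard G F, F.card))
    wellFounded_lt).has_min {F | F.Nonempty} ⟨{Classical.arbitrary V}, by simp⟩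
  have hmin' : ∀ F : Finset V, F.Nonempty →
      cutCard G A < cutCard G F ∨ cutCard G A = cutCard G F ∧ A.card ≤ F.card := by
    intro F hF
    have := hmin F hF
    simp only [InvImage, Prod.Lex.toLex_lt_toLex] at this
    omega
  refine ⟨A, hA, fun F hF => by have := hmin' F hF; omega, fun φ hφ => ?_⟩
  have hsub := cutCard_inter_add_cutCard_union_le G A (A.map φ.toEquiv.toEmbedding)
  rw [cutCard_map_iso] at hsub
  have hi := hmin' _ hφ
  have hu := hmin' (A ∪ A.map φ.toEquiv.toEmbedding) (hA.mono Finset.subset_union_left)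
  have hc : A.card ≤ (A ∩ A.map φ.toEquiv.toEmbedding).card := by omega
  have hAB := Finset.inter_eq_left.mp (Finset.eq_of_subset_of_card_le Finset.inter_subset_left hc)
  exact (Finset.eq_of_subset_of_card_le hAB (by simp)).symm

/-- If every nonempty finite set has a nonempty edge boundary, then in a vertex-transitive
`d`-regular graph these boundaries have at least `d` edges. -/
theorem le_cutCard_of_transitive [Nonempty V] {d : ℕ} (hd : ∀ v, (G.neighborFinset v).card = d)
    (htrans : ∀ u v : V, ∃ φ : G ≃g G, φ u = v)
    (hpos : ∀ F : Finset V, F.Nonempty → 0 < cutCard G F) {F : Finset V} (hF : F.Nonempty) :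
    d ≤ cutCard G F := by
  obtain ⟨A, ⟨a, ha⟩, hmin, hblock⟩ := exists_minimal_cutCard_block G
  refine le_trans ?_ (hmin F hF)
  have hconst : ∀ v ∈ A, (G.neighborFinset v \ A).card = (G.neighborFinset a \ A).card := by
    intro v hv
    obtain ⟨φ, rfl⟩ := htrans a v
    have hφ := hblock φ ⟨φ a, Finset.mem_inter.mpr ⟨hv, Finset.mem_map_of_mem _ ha⟩⟩
    have := card_neighborFinset_apply_iso_sdiff G φ A a
    rwa [hφ] at this
  have hcut : cutCard G A = A.card * (G.neighborFinset a \ A).card := by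
    rw [cutCard, Finset.sum_congr rfl hconst, Finset.sum_const, smul_eq_mul]
  have hcutpos := hpos A ⟨a, ha⟩
  have hinner : (G.neighborFinset a ∩ A).card ≤ A.card - 1 := by
    rw [← Finset.card_erase_of_mem ha]
    refine Finset.card_le_card fun w hw => ?_
    simp only [Finset.mem_inter, SimpleGraph.mem_neighborFinset] at hw
    exact Finset.mem_erase.mpr ⟨hw.1.ne', hw.2⟩
  have hsplit := Finset.card_sdiff_add_card_inter (G.neighborFinset a) A
  rw [hd] at hsplit
  rw [hcut] at hcutpos ⊢
  have hr := Nat.pos_of_mul_pos_left hcutpos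
  have hm := Finset.card_pos.mpr ⟨a, ha⟩
  generalize (G.neighborFinset a \ A).card = r at *
  generalize A.card = m at *
  obtain ⟨r, rfl⟩ := Nat.exists_eq_add_of_le' hr
  obtain ⟨m, rfl⟩ := Nat.exists_eq_add_of_le' hm
  simp only [Nat.add_sub_cancel] at hinner
  nlinarith [Nat.zero_le (m * r)]

theorem cutCard_eq_sum_of_neighbors_subset {C X : Finset V} (hdisj : Disjoint C X)
    (hnb : ∀ v ∈ C, G.neighborFinset v ⊆ C ∪ X) :
    cutCard G C = ∑ x ∈ X, (G.neighborFinset x ∩ C).card := by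
  classical
  have h := Finset.sum_card_bipartiteAbove_eq_sum_card_bipartiteBelow (s := C) (t := X) G.Adj
  have h1 : cutCard G C = ∑ v ∈ C, (X.bipartiteAbove G.Adj v).card := by
    refine Finset.sum_congr rfl fun v hv => congrArg _ ?_
    ext w
    have h2 := @hnb v hv w
    have h3 : w ∈ X → w ∉ C := fun hw => Finset.disjoint_right.mp hdisj hw
    simp only [Finset.mem_sdiff, Finset.mem_bipartiteAbove, Finset.mem_union,
      SimpleGraph.mem_neighborFinset] at *
    tauto
  rw [h1, h]
  refine Finset.sum_congr rfl fun x _ => congrArg _ ?_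
  ext w
  simp [G.adj_comm x w, and_comm]

/-- Finitely many disjoint sets whose boundaries lie in `X`, each emitting at least `d` edges,
use up at least `d` of the edge slots at `X` apiece. -/
theorem mul_card_add_cutCard_le {ι : Type*} {d : ℕ} (hd : ∀ v, (G.neighborFinset v).card = d)
    (X : Finset V) (S : Finset ι) (C : ι → Finset V)
    (hC : (S : Set ι).PairwiseDisjoint C) (hX : ∀ i ∈ S, Disjoint (C i) X)
    (hnb : ∀ i ∈ S, ∀ v ∈ C i, G.neighborFinset v ⊆ C i ∪ X)
    (hcut : ∀ i ∈ S, d ≤ cutCard G (C i)) :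
    d * S.card + cutCard G (X ∪ S.biUnion C) ≤ d * X.card := by
  have h1 : d * S.card ≤ ∑ x ∈ X, ∑ i ∈ S, (G.neighborFinset x ∩ C i).card := by
    rw [Finset.sum_comm, mul_comm, ← smul_eq_mul, ← Finset.sum_const]
    refine Finset.sum_le_sum fun i hi => ?_
    rw [← cutCard_eq_sum_of_neighbors_subset G (hX i hi) (hnb i hi)]
    exact hcut i hi
  have h2 : cutCard G (X ∪ S.biUnion C) =
      ∑ x ∈ X, (G.neighborFinset x \ (X ∪ S.biUnion C)).card := by
    refine (Finset.sum_subset Finset.subset_union_left fun v hv hvX => ?_).symm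
    obtain ⟨i, hi, hvi⟩ := Finset.mem_biUnion.mp ((Finset.mem_union.mp hv).resolve_left hvX)
    rw [Finset.card_eq_zero, Finset.sdiff_eq_empty_iff_subset, Finset.union_comm]
    exact (hnb i hi v hvi).trans
      (Finset.union_subset_union_left (Finset.subset_biUnion_of_mem C hi))
  have h3 : ∀ x ∈ X, ∑ i ∈ S, (G.neighborFinset x ∩ C i).card +
      (G.neighborFinset x \ (X ∪ S.biUnion C)).card ≤ d := by
    intro x _
    rw [← Finset.card_biUnion fun i hi j hj hij => (hC hi hj hij).mono
      Finset.inter_subset_right Finset.inter_subset_right, ← Finset.inter_biUnion, ← hd x,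
      ← Finset.card_inter_add_card_sdiff (G.neighborFinset x) (S.biUnion C)]
    gcongr
    exact Finset.subset_union_right
  calc d * S.card + cutCard G (X ∪ S.biUnion C)
      ≤ ∑ x ∈ X, (∑ i ∈ S, (G.neighborFinset x ∩ C i).card +
          (G.neighborFinset x \ (X ∪ S.biUnion C)).card) := by
        rw [Finset.sum_add_distrib, ← h2]; gcongr
    _ ≤ ∑ _x ∈ X, d := Finset.sum_le_sum h3
    _ = d * X.card := by rw [Finset.sum_const, smul_eq_mul, mul_comm]

theorem ncard_edgesBetween_compl_le_cutCard (F : Finset V) :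
    (edgesBetween G F (F : Set V)ᶜ).ncard ≤ cutCard G F := by
  rw [cutCard, ← Finset.card_sigma]
  refine le_trans ?_ (Finset.card_image_le (f := fun p : (_ : V) × V => s(p.1, p.2)))
  rw [← Set.ncard_coe_finset]
  refine Set.ncard_le_ncard ?_ (Finset.finite_toSet _)
  rintro e ⟨he, a, ha, b, hb, rfl⟩
  simp only [Finset.coe_image, Set.mem_image]
  exact ⟨⟨a, b⟩, by simpa using ⟨ha, he, hb⟩, rfl⟩

end CutCard

theorem mem_or_mem_image_supp_of_adj {V : Type*} {G : SimpleGraph V} {X : Set V}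
    (C : (G.induce Xᶜ).ConnectedComponent) {v w : V} (hv : v ∈ Subtype.val '' C.supp)
    (h : G.Adj v w) : w ∈ Subtype.val '' C.supp ∨ w ∈ X := by
  obtain ⟨v, hv, rfl⟩ := hv
  refine or_iff_not_imp_right.mpr fun hw => ⟨⟨w, hw⟩, ?_, rfl⟩
  exact C.mem_supp_of_adj_mem_supp hv h

theorem disjoint_image_supp {V : Type*} {G : SimpleGraph V} {X : Set V}
    {C D : (G.induce Xᶜ).ConnectedComponent} (h : C ≠ D) :
    Disjoint (Subtype.val '' C.supp) (Subtype.val '' D.supp) :=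
  (Set.disjoint_image_iff Subtype.val_injective).mpr
    (SimpleGraph.pairwise_disjoint_supp_connectedComponent _ h)

/-- The isoperimetric inequality for a `d`-regular vertex-transitive graph with expansion
constant `δ`. -/
theorem ncard_finComponents_add_le {V : Type*} [Nonempty V] (G : SimpleGraph V)
    (hLF : ∀ v : V, (G.neighborSet v).Finite)
    (htrans : ∀ u v : V, ∃ φ : G ≃g G, φ u = v) {d : ℕ} {δ : ℝ} (hδ : 0 < δ)
    (hd : ∀ v : V, (G.neighborSet v).ncard = d)
    (hexp : ∀ F : Set V, F.Finite → δ * F.ncard ≤ ((edgesBetween G F Fᶜ).ncard : ℝ)) :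
    0 < d ∧ ∀ X : Set V, X.Finite → (finComponents G X).Finite ∧ (hullFin G X).Finite ∧
      (finComponents G X).ncard + (δ / d) * (hullFin G X).ncard ≤ (X.ncard : ℝ) := by
  classical
  have : G.LocallyFinite := fun v => (hLF v).fintype
  have hd' : ∀ v, (G.neighborFinset v).card = d := fun v => by
    rw [← hd v, ← SimpleGraph.coe_neighborFinset, Set.ncard_coe_finset]
  have hcut : ∀ F : Finset V, δ * F.card ≤ cutCard G F := fun F => by
    have h := hexp F F.finite_toSet
    rw [Set.ncard_coe_finset] at h
    exact h.trans (by exact_mod_cast ncard_edgesBetween_compl_le_cutCard G F)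
  have hpos : ∀ F : Finset V, F.Nonempty → 0 < cutCard G F := fun F hF => by
    have : (0 : ℝ) < F.card := by exact_mod_cast hF.card_pos
    exact_mod_cast (mul_pos hδ this).trans_le (hcut F)
  have hd0 : 0 < d := by
    have h := hpos {Classical.arbitrary V} (by simp)
    rw [cutCard, Finset.sum_singleton] at h
    exact h.trans_le ((Finset.card_le_card Finset.sdiff_subset).trans (hd' _).le)
  refine ⟨hd0, fun X hX => ?_⟩
  lift X to Finset V using hX
  let C : (G.induce (X : Set V)ᶜ).ConnectedComponent → Finset V := fun c =>
    if h : c.supp.Finite then (h.image Subtype.val).toFinset else ∅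
  have hCcoe : ∀ c ∈ finComponents G (X : Set V), (C c : Set V) = Subtype.val '' c.supp := by
    intro c hc
    simp [C, show c.supp.Finite from hc]
  have key : ∀ S : Finset (G.induce (X : Set V)ᶜ).ConnectedComponent,
      (S : Set _) ⊆ finComponents G (X : Set V) →
      d * S.card + cutCard G (X ∪ S.biUnion C) ≤ d * X.card := by
    intro S hS
    refine mul_card_add_cutCard_le G hd' X S C ?_ ?_ ?_ ?_
    · intro c hc c' hc' hne
      rw [Function.onFun, ← Finset.disjoint_coe, hCcoe c (hS hc), hCcoe c' (hS hc')]
      exact disjoint_image_supp hne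
    · intro c hc
      rw [← Finset.disjoint_coe, hCcoe c (hS hc), Set.disjoint_left]
      rintro _ ⟨v, -, rfl⟩
      exact v.2
    · intro c hc v hv w hw
      rw [← Finset.mem_coe, hCcoe c (hS hc)] at hv
      rw [Finset.mem_union, ← Finset.mem_coe, hCcoe c (hS hc)]
      exact mem_or_mem_image_supp_of_adj c hv (by simpa using hw)
    · intro c hc
      refine le_cutCard_of_transitive G hd' htrans hpos ?_
      rw [← Finset.coe_nonempty, hCcoe c (hS hc)]
      exact c.nonempty_supp.image _
  have hfin : (finComponents G (X : Set V)).Finite := by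
    by_contra hinf
    obtain ⟨S, hS, hcard⟩ := Set.Infinite.exists_subset_card_eq hinf (X.card + 1)
    have := key S hS
    rw [hcard] at this
    nlinarith
  have hhull : hullFin G (X : Set V) = (X ∪ hfin.toFinset.biUnion C : Finset V) := by
    rw [hullFin, Finset.coe_union, Finset.coe_biUnion, Set.image_iUnion₂]
    congr 1
    simp only [Set.Finite.coe_toFinset]
    exact Set.iUnion₂_congr fun c hc => (hCcoe c hc).symm
  refine ⟨hfin, hhull ▸ Finset.finite_toSet _, ?_⟩
  have h1 := key hfin.toFinset (by simp)
  have h2 := hcut (X ∪ hfin.toFinset.biUnion C)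
  rw [hhull, Set.ncard_coe_finset, Set.ncard_coe_finset, Set.ncard_eq_toFinset_card _ hfin]
  have h1' : (d : ℝ) * hfin.toFinset.card + cutCard G (X ∪ hfin.toFinset.biUnion C)
      ≤ d * X.card := by exact_mod_cast h1
  have hdR : (0 : ℝ) < d := by exact_mod_cast hd0
  refine le_of_mul_le_mul_left ?_ hdR
  calc (d : ℝ) * (hfin.toFinset.card + δ / d * (X ∪ hfin.toFinset.biUnion C).card)
      = d * hfin.toFinset.card + δ * (X ∪ hfin.toFinset.biUnion C).card := by field_simp
    _ ≤ d * X.card := by linarith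

/-- For an infinite, connected, locally finite, non-amenable, vertex
transitive graph `G`, there is `ε > 0` with `|X| ≥ |C_fin(X)| + ε|hull_fin(X)|` for all
finite `X`; moreover, if `G` is `d`-regular with expansion constant `δ`, one may take
`ε = δ/d`. -/
theorem stmt_6 {V : Type*} [Infinite V] (G : SimpleGraph V)
    (hconn : G.Connected)
    (hLF : ∀ v : V, (G.neighborSet v).Finite)
    (hnonamenable : ∃ δ : ℝ, 0 < δ ∧ ∀ F : Set V, F.Finite →
      δ * F.ncard ≤ ((edgesBetween G F Fᶜ).ncard : ℝ))
    (htrans : ∀ u v : V, ∃ φ : G ≃g G, φ u = v) :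
    (∃ ε : ℝ, 0 < ε ∧ ∀ X : Set V, X.Finite →
      (finComponents G X).Finite ∧ (hullFin G X).Finite ∧
      (finComponents G X).ncard + ε * (hullFin G X).ncard ≤ (X.ncard : ℝ)) ∧
    (∀ d : ℕ, ∀ δ : ℝ, 0 < δ →
      (∀ v : V, (G.neighborSet v).ncard = d) →
      (∀ F : Set V, F.Finite → δ * F.ncard ≤ ((edgesBetween G F Fᶜ).ncard : ℝ)) →
      ∀ X : Set V, X.Finite →
        (finComponents G X).Finite ∧ (hullFin G X).Finite ∧
        (finComponents G X).ncard + (δ / d) * (hullFin G X).ncard ≤ (X.ncard : ℝ)) := by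
  constructor
  · obtain ⟨δ, hδ, hexp⟩ := hnonamenable
    let o := Classical.arbitrary V
    have hd : ∀ v : V, (G.neighborSet v).ncard = (G.neighborSet o).ncard := by
      intro v
      obtain ⟨φ, rfl⟩ := htrans o v
      rw [← φ.image_neighborSet, Set.ncard_image_of_injective _ φ.injective]
    obtain ⟨hd0, h⟩ := ncard_finComponents_add_le G hLF htrans hδ hd hexp
    exact ⟨_, div_pos hδ (Nat.cast_pos.mpr hd0), h⟩
  · intro d δ hδ hd hexp
    exact (ncard_finComponents_add_le G hLF htrans hδ hd hexp).2
end

section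
/- Let G be an infinite, connected, locally finite, non-amenable, vertex-transitive graph. Then there exists ε > 0 such that for all finite X ⊆ V(G), |X| ≥ |C_odd(X)| + ε·|hull_odd(X)|. -/
open Set

/-- The finite odd connected components of the induced subgraph of `G` on `V \ X`. -/
def oddComponents {V : Type*} (G : SimpleGraph V) (X : Set V) :
    Set ((G.induce Xᶜ).ConnectedComponent) :=
  {C | C.supp.Finite ∧ Odd C.supp.ncard}

/-- `hull_odd(X) := X ∪ ⋃ C_odd(X)`. -/
def hullOdd {V : Type*} (G : SimpleGraph V) (X : Set V) : Set V :=
  X ∪ Subtype.val '' (⋃ C ∈ oddComponents G X, C.supp)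

namespace SimpleGraph

variable {V : Type*} (G : SimpleGraph V)

section Interedges

variable [DecidableRel G.Adj]

lemma card_interedges_eq_sum (A B : Finset V) :
    (G.interedges A B).card = ∑ v ∈ A, (B.filter (G.Adj v)).card := by
  rw [interedges_def, Finset.card_filter, Finset.sum_product]
  simp only [Finset.card_filter]

lemma card_interedges_symm (A B : Finset V) :
    (G.interedges A B).card = (G.interedges B A).card :=
  have : Std.Symm G.Adj := ⟨fun _ _ h => h.symm⟩
  Rel.card_interedges_comm (r := G.Adj) A B

variable {G} in
lemma IsRegularOfDegree.card_interedges_eq [G.LocallyFinite] {d : ℕ}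
    (hd : G.IsRegularOfDegree d) {A B : Finset V} (h : ∀ v ∈ A, G.neighborFinset v ⊆ B) :
    (G.interedges A B).card = d * A.card := by
  rw [card_interedges_eq_sum, Finset.sum_congr rfl (g := fun _ => d), Finset.sum_const,
    smul_eq_mul, mul_comm]
  intro v hv
  rw [← hd v, ← card_neighborFinset_eq_degree]
  congr 1
  ext w
  simp only [Finset.mem_filter, mem_neighborFinset, and_iff_right_iff_imp]
  exact fun hw => h v hv (by simpa using hw)

variable [DecidableEq V]

lemma card_interedges_union_left {A B : Finset V} (h : Disjoint A B) (C : Finset V) :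
    (G.interedges (A ∪ B) C).card = (G.interedges A C).card + (G.interedges B C).card := by
  simp only [card_interedges_eq_sum, Finset.sum_union h]

lemma card_interedges_union_right (A : Finset V) {B C : Finset V} (h : Disjoint B C) :
    (G.interedges A (B ∪ C)).card = (G.interedges A B).card + (G.interedges A C).card := by
  rw [card_interedges_symm, card_interedges_union_left _ h, card_interedges_symm _ B,
    card_interedges_symm _ C]

lemma card_interedges_self_supermodular (A B : Finset V) :
    (G.interedges A A).card + (G.interedges B B).card ≤
      (G.interedges (A ∪ B) (A ∪ B)).card + (G.interedges (A ∩ B) (A ∩ B)).card := by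
  rw [← Finset.card_union_add_card_inter]
  refine Nat.add_le_add (Finset.card_le_card (Finset.union_subset ?_ ?_))
    (Finset.card_le_card fun e he => ?_)
  · exact G.interedges_mono Finset.subset_union_left Finset.subset_union_left
  · exact G.interedges_mono Finset.subset_union_right Finset.subset_union_right
  · simp only [Finset.mem_inter, mem_interedges_iff] at he ⊢
    tauto

variable [G.LocallyFinite] {G} {d : ℕ}

lemma IsRegularOfDegree.card_interedges_le (hd : G.IsRegularOfDegree d) (A B : Finset V) :
    (G.interedges A B).card ≤ d * A.card := by
  rw [← hd.card_interedges_eq (A := A) (B := B ∪ A.biUnion fun v => G.neighborFinset v)]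
  · exact Finset.card_le_card (G.interedges_mono subset_rfl Finset.subset_union_left)
  · exact fun v hv => (Finset.subset_biUnion_of_mem (fun v => G.neighborFinset v) hv).trans
      Finset.subset_union_right

lemma IsRegularOfDegree.ncard_edgesBetween_add_le (hd : G.IsRegularOfDegree d) (F : Finset V) :
    (edgesBetween G F (F : Set V)ᶜ).ncard + (G.interedges F F).card ≤ d * F.card := by
  set N := F.biUnion (fun v => G.neighborFinset v) \ F with hN
  have hsub : edgesBetween G F (F : Set V)ᶜ ⊆
      ((G.interedges F N).image fun p => s(p.1, p.2) : Finset (Sym2 V)) := by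
    rintro e ⟨he, a, ha, b, hb, rfl⟩
    simp only [Finset.coe_image, Set.mem_image, Finset.mem_coe]
    refine ⟨(a, b), ?_, rfl⟩
    rw [mk_mem_interedges_iff]
    refine ⟨ha, ?_, he⟩
    simp only [hN, Finset.mem_sdiff, Finset.mem_biUnion, mem_neighborFinset]
    exact ⟨⟨a, ha, he⟩, hb⟩
  have hle : (edgesBetween G F (F : Set V)ᶜ).ncard ≤ (G.interedges F N).card := by
    refine (Set.ncard_le_ncard hsub (Finset.finite_toSet _)).trans ?_
    rw [Set.ncard_coe_finset]
    exact Finset.card_image_le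
  have hdisj : Disjoint N F := Finset.sdiff_disjoint
  have := hd.card_interedges_le F (N ∪ F)
  rw [card_interedges_union_right _ _ hdisj] at this
  omega

end Interedges

/-- In a regular vertex-transitive graph whose nonempty finite vertex sets all have nonempty edge
boundary, every such edge boundary has at least as many edges as the degree. -/
theorem IsRegularOfDegree.card_interedges_self_add_degree_le [DecidableEq V] [DecidableRel G.Adj]
    [G.LocallyFinite] {d : ℕ} (hd : G.IsRegularOfDegree d)
    (htrans : ∀ u v : V, ∃ φ : G ≃g G, φ u = v)
    (hpos : ∀ F : Finset V, F.Nonempty → (G.interedges F F).card < d * F.card)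
    (F : Finset V) (hF : F.Nonempty) : (G.interedges F F).card + d ≤ d * F.card := by
  by_contra! hlt
  let f : Finset V → ℕ ×ₗ ℕ :=
    fun B => toLex (d * B.card - (G.interedges B B).card, B.card)
  obtain ⟨A, hAne, hAmin⟩ :=
    exists_minimalFor_of_wellFoundedLT (fun B : Finset V => B.Nonempty) f ⟨F, hF⟩
  have hmin : ∀ B : Finset V, B.Nonempty →
      d * A.card - (G.interedges A A).card < d * B.card - (G.interedges B B).card ∨
      d * A.card - (G.interedges A A).card = d * B.card - (G.interedges B B).card ∧
        A.card ≤ B.card := by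
    intro B hB
    have : f A ≤ f B := (le_total (f A) (f B)).elim id (hAmin hB)
    simpa [f, Prod.Lex.toLex_le_toLex] using this
  have hatom : ∀ B : Finset V, B.card = A.card →
      (G.interedges B B).card = (G.interedges A A).card → (A ∩ B).Nonempty → A = B := by
    intro B hB hBe hne
    have h1 := hmin _ hne
    have h2 := hmin _ (hne.mono (Finset.inter_subset_union))
    have h3 := G.card_interedges_self_supermodular A B
    have h4 := congrArg (d * ·) (Finset.card_union_add_card_inter A B)
    simp only [mul_add, hB] at h4
    have h5 := hd.card_interedges_le (A ∩ B) (A ∩ B)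
    have h6 := hd.card_interedges_le (A ∪ B) (A ∪ B)
    have h7 := hd.card_interedges_le A A
    have hle : A.card ≤ (A ∩ B).card := by omega
    have hi : A ∩ B = A := Finset.eq_of_subset_of_card_le Finset.inter_subset_left hle
    have hi' : A ∩ B = B :=
      Finset.eq_of_subset_of_card_le Finset.inter_subset_right (hB.trans_le hle)
    exact hi.symm.trans hi'
  obtain ⟨u, hu⟩ := hAne
  have hconst : ∀ v ∈ A, (A.filter (G.Adj v)).card = (A.filter (G.Adj u)).card := by
    intro v hv
    obtain ⟨φ, hφ⟩ := htrans u v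
    have hAB : A = A.map φ.toEquiv.toEmbedding := by
      refine hatom _ (Finset.card_map _) ?_ ⟨v, ?_⟩
      · simp only [card_interedges_eq_sum, Finset.sum_map, Finset.filter_map, Finset.card_map]
        refine Finset.sum_congr rfl fun x _ => ?_
        congr 2
        ext y
        exact φ.map_adj_iff
      · simp only [Finset.mem_inter, Finset.mem_map]
        exact ⟨hv, u, hu, hφ⟩
    conv_lhs => rw [hAB]
    rw [Finset.filter_map, Finset.card_map]
    congr 2
    ext y
    rw [← hφ]
    exact φ.map_adj_iff
  have hsum : (G.interedges A A).card = A.card * (A.filter (G.Adj u)).card := by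
    rw [card_interedges_eq_sum, Finset.sum_congr rfl hconst, Finset.sum_const, smul_eq_mul]
  have hk : (A.filter (G.Adj u)).card + 1 ≤ A.card :=
    Finset.card_lt_card (Finset.filter_ssubset.2 ⟨u, hu, G.irrefl⟩)
  have hA := hpos A ⟨u, hu⟩
  have hAlt : d * A.card < (G.interedges A A).card + d := by
    have := hmin F hF
    have := hpos F hF
    omega
  rw [hsum] at hA hAlt
  generalize (A.filter (G.Adj u)).card = k at *
  generalize A.card = a at *
  have hkd : k + 1 ≤ d := by
    by_contra! h
    nlinarith
  obtain ⟨m, rfl⟩ := Nat.exists_eq_add_of_le hkd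
  obtain ⟨n, rfl⟩ := Nat.exists_eq_add_of_le hk
  nlinarith [Nat.zero_le (n * m), Nat.zero_le (k * m)]

/-- Double counting of the edges leaving a family of vertex sets which are separated from each
other and from the outside by `X`. -/
theorem IsRegularOfDegree.card_mul_add_le_of_separated [DecidableEq V] [DecidableRel G.Adj]
    [G.LocallyFinite] {d : ℕ} (hd : G.IsRegularOfDegree d)
    (hbdry : ∀ F : Finset V, F.Nonempty → (G.interedges F F).card + d ≤ d * F.card)
    {ι : Type*} (S : Finset ι) (X : Finset V) (C : ι → Finset V)
    (hne : ∀ i ∈ S, (C i).Nonempty) (hX : ∀ i ∈ S, Disjoint X (C i))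
    (hdisj : (S : Set ι).PairwiseDisjoint C)
    (hadj : ∀ i ∈ S, ∀ v ∈ C i, G.neighborFinset v ⊆ X ∪ C i) :
    d * S.card + d * (X ∪ S.biUnion C).card ≤
      d * X.card + (G.interedges (X ∪ S.biUnion C) (X ∪ S.biUnion C)).card := by
  set D := S.biUnion C with hD
  have hXD : Disjoint X D := (Finset.disjoint_biUnion_right _ _ _).2 hX
  have hDD : (G.interedges D D).card = ∑ i ∈ S, (G.interedges (C i) (C i)).card := by
    rw [card_interedges_eq_sum, hD, Finset.sum_biUnion hdisj]
    refine Finset.sum_congr rfl fun i hi => ?_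
    rw [card_interedges_eq_sum]
    refine Finset.sum_congr rfl fun v hv => ?_
    congr 1
    ext w
    simp only [Finset.mem_filter, and_congr_left_iff]
    refine fun hvw => ⟨fun hw => ?_, fun hw => Finset.mem_biUnion.2 ⟨i, hi, hw⟩⟩
    have := hadj i hi v hv (by simpa using hvw)
    exact (Finset.mem_union.1 this).resolve_left fun h => Finset.disjoint_left.1 hXD h hw
  have hDH : (G.interedges D (X ∪ D)).card = d * D.card := by
    refine hd.card_interedges_eq fun v hv => ?_
    obtain ⟨i, hi, hvi⟩ := Finset.mem_biUnion.1 hv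
    exact (hadj i hi v hvi).trans
      (Finset.union_subset_union_right (Finset.subset_biUnion_of_mem C hi))
  have hsum : ∑ i ∈ S, (G.interedges (C i) (C i)).card + d * S.card ≤ d * D.card := by
    rw [hD, Finset.card_biUnion hdisj, Finset.mul_sum, mul_comm d S.card, ← smul_eq_mul (S.card),
      ← Finset.sum_const, ← Finset.sum_add_distrib]
    exact Finset.sum_le_sum fun i hi => hbdry _ (hne i hi)
  have hHH := G.card_interedges_union_left hXD (X ∪ D)
  rw [G.card_interedges_union_right X hXD, G.card_interedges_symm X D] at hHH
  rw [G.card_interedges_union_right D hXD] at hDH hHH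
  rw [Finset.card_union_of_disjoint hXD, mul_add]
  omega

end SimpleGraph

/-- For an infinite, connected, locally finite, non-amenable, vertex
transitive graph `G`, there is `ε > 0` with `|X| ≥ |C_odd(X)| + ε|hull_odd(X)|` for all
finite `X ⊆ V(G)`. -/
theorem stmt_7 {V : Type*} [Infinite V] (G : SimpleGraph V)
    (hconn : G.Connected)
    (hLF : ∀ v : V, (G.neighborSet v).Finite)
    (hnonamenable : ∃ δ : ℝ, 0 < δ ∧ ∀ F : Set V, F.Finite →
      δ * F.ncard ≤ ((edgesBetween G F Fᶜ).ncard : ℝ))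
    (htrans : ∀ u v : V, ∃ φ : G ≃g G, φ u = v) :
    ∃ ε : ℝ, 0 < ε ∧ ∀ X : Set V, X.Finite →
      (oddComponents G X).Finite ∧ (hullOdd G X).Finite ∧
      (oddComponents G X).ncard + ε * (hullOdd G X).ncard ≤ (X.ncard : ℝ) := by
  classical
  obtain ⟨δ, hδ, hiso⟩ := hnonamenable
  have : G.LocallyFinite := fun v => (hLF v).fintype
  obtain ⟨v₀⟩ := hconn.nonempty
  set d := G.degree v₀ with hd₀
  have hd : G.IsRegularOfDegree d := by
    intro v
    obtain ⟨φ, hφ⟩ := htrans v v₀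
    rw [hd₀, ← hφ]
    exact (φ.degree_eq v).symm
  have hamen : ∀ F : Finset V, δ * F.card + (G.interedges F F).card ≤ (d : ℝ) * F.card := by
    intro F
    have h1 := hiso F F.finite_toSet
    rw [Set.ncard_coe_finset] at h1
    have h2 : ((edgesBetween G F (F : Set V)ᶜ).ncard : ℝ) + (G.interedges F F).card ≤
        d * F.card := by exact_mod_cast hd.ncard_edgesBetween_add_le F
    linarith
  have hpos : ∀ F : Finset V, F.Nonempty → (G.interedges F F).card < d * F.card := by
    intro F hF
    have h1 := hamen F
    have h2 : 0 < δ * F.card := mul_pos hδ (by exact_mod_cast hF.card_pos)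
    have h3 : ((G.interedges F F).card : ℝ) < d * F.card := by linarith
    exact_mod_cast h3
  have hdpos : 0 < d := by
    have := hpos {v₀} (Finset.singleton_nonempty _)
    rw [Finset.card_singleton] at this
    omega
  have hbdry := hd.card_interedges_self_add_degree_le G htrans hpos
  refine ⟨δ / d, by positivity, fun X hX => ?_⟩
  lift X to Finset V using hX
  have hCfin : ∀ i : oddComponents G (X : Set V), (Subtype.val '' i.1.supp).Finite :=
    fun i => i.2.1.image _
  let C : oddComponents G (X : Set V) → Finset V := fun i => (hCfin i).toFinset
  have hmemC : ∀ i v, v ∈ C i ↔ ∃ h : v ∈ (X : Set V)ᶜ, (⟨v, h⟩ : ↥(X : Set V)ᶜ) ∈ i.1.supp := by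
    intro i v
    simp [C]
  have hkey : ∀ S : Finset (oddComponents G (X : Set V)),
      d * S.card + d * (X ∪ S.biUnion C).card ≤
        d * X.card + (G.interedges (X ∪ S.biUnion C) (X ∪ S.biUnion C)).card := by
    intro S
    refine hd.card_mul_add_le_of_separated G hbdry S X C ?_ ?_ ?_ ?_
    · intro i _
      obtain ⟨v, hv⟩ := i.1.nonempty_supp
      exact ⟨v, (hmemC i v).2 ⟨v.2, hv⟩⟩
    · intro i _
      refine Finset.disjoint_right.2 fun v hv => ?_
      exact ((hmemC i v).1 hv).1
    · intro i _ j _ hij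
      refine Finset.disjoint_left.2 fun v hi hj => hij ?_
      obtain ⟨_, hi⟩ := (hmemC i v).1 hi
      obtain ⟨_, hj⟩ := (hmemC j v).1 hj
      exact Subtype.ext (SimpleGraph.ConnectedComponent.eq_of_common_vertex hi hj)
    · intro i _ v hv w hw
      obtain ⟨hvX, hv⟩ := (hmemC i v).1 hv
      rw [SimpleGraph.mem_neighborFinset] at hw
      by_cases hwX : w ∈ X
      · exact Finset.mem_union_left _ hwX
      · refine Finset.mem_union_right _ ((hmemC i w).2 ⟨hwX, ?_⟩)
        exact i.1.mem_supp_of_adj_mem_supp hv (SimpleGraph.induce_adj.2 hw)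
  have hSle : ∀ S : Finset (oddComponents G (X : Set V)), S.card ≤ X.card := by
    intro S
    have h1 := hkey S
    have h2 := hd.card_interedges_le (X ∪ S.biUnion C) (X ∪ S.biUnion C)
    exact Nat.le_of_mul_le_mul_left (by omega) hdpos
  have hfin : (oddComponents G (X : Set V)).Finite := by
    by_contra hinf
    have := Set.infinite_coe_iff.2 hinf
    obtain ⟨S, hS⟩ := Infinite.exists_subset_card_eq (oddComponents G (X : Set V)) (X.card + 1)
    have := hSle S
    omega
  have := hfin.fintype
  have hhull : hullOdd G (X : Set V) = (X ∪ Finset.univ.biUnion C : Finset V) := by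
    ext v
    simp only [hullOdd, Finset.coe_union, Set.mem_union, Finset.mem_coe, Finset.mem_biUnion,
      Finset.mem_univ, true_and, hmemC, Set.mem_image, Set.mem_iUnion]
    refine or_congr_right ⟨?_, ?_⟩
    · rintro ⟨w, ⟨c, hc, hw⟩, rfl⟩
      exact ⟨⟨c, hc⟩, w.2, hw⟩
    · rintro ⟨c, h, hv⟩
      exact ⟨⟨v, h⟩, ⟨c.1, c.2, hv⟩, rfl⟩
  refine ⟨hfin, hhull ▸ Finset.finite_toSet _, ?_⟩
  rw [hhull, Set.ncard_coe_finset, Set.ncard_coe_finset, ← Nat.card_coe_set_eq,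
    Nat.card_eq_fintype_card, ← Finset.card_univ]
  have h1 := hamen (X ∪ Finset.univ.biUnion C)
  have h2 := hkey Finset.univ
  have h3 : (d : ℝ) * (Finset.univ : Finset (oddComponents G (X : Set V))).card +
      d * (X ∪ Finset.univ.biUnion C).card ≤ d * X.card +
        (G.interedges (X ∪ Finset.univ.biUnion C) (X ∪ Finset.univ.biUnion C)).card := by
    exact_mod_cast h2
  have hd' : (0 : ℝ) < d := by exact_mod_cast hdpos
  refine le_of_mul_le_mul_left ?_ hd'
  rw [mul_add, ← mul_assoc, mul_div_cancel₀ _ hd'.ne']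
  linarith
end

section
/- (Marks–Unger.) Let G be a locally finite bipartite Borel graph on a Polish space with bipartition V(G) = B₀ ⊔ B₁ (the sets B₀ and B₁ need not be Borel). Suppose there exists ε > 0 such that whenever F is a finite set contained in either B₀ or B₁, the neighborhood satisfies |N(F)| ≥ (1+ε)|F|. Then there exists a Borel G-invariant comeager set S ⊆ V(G) and a Borel set M of edges of G such that M is a perfect matching of the induced subgraph of G on S. -/
open Set

/-- `S` is a union of connected components of `G`. -/
def Invariant {V : Type*} (G : SimpleGraph V) (S : Set V) : Prop :=
  ∀ ⦃x⦄, x ∈ S → ∀ ⦃y⦄, G.Reachable x y → y ∈ S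

/-- `M` (a symmetric set of ordered pairs) is a perfect matching of the induced
subgraph of `G` on `S`. -/
def IsPerfectMatchingOn {V : Type*} (G : SimpleGraph V) (S : Set V) (M : Set (V × V)) : Prop :=
  (∀ p ∈ M, G.Adj p.1 p.2) ∧
  (∀ x y : V, (x, y) ∈ M → (y, x) ∈ M) ∧
  (∀ p ∈ M, p.1 ∈ S ∧ p.2 ∈ S) ∧
  (∀ x ∈ S, ∃! y : V, (x, y) ∈ M)

/-- The sets `A n` are contained in measurable sets with empty intersection. -/
def MeasurablyNullSeparable {α : Type*} [MeasurableSpace α] (A : ℕ → Set α) : Prop :=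
  ∃ B : ℕ → Set α, (∀ n, A n ⊆ B n) ∧ (∀ n, MeasurableSet (B n)) ∧ ⋂ n, B n = ∅

theorem MeasurablyNullSeparable.of_cover {α : Type*} [MeasurableSpace α] {A : ℕ → Set α}
    {C : ℕ → ℕ → Set α} (i : ℕ) (hne : ∀ j, ∀ n ≠ i, A n ⊆ C j n) (hi : A i ⊆ ⋃ j, C j i)
    (h : ∀ j, MeasurablyNullSeparable (C j)) : MeasurablyNullSeparable A := by
  choose B hCB hB hBe using h
  refine ⟨fun n => if n = i then ⋃ j, B j i else ⋂ j, B j n, fun n => ?_, fun n => ?_, ?_⟩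
  · by_cases hn : n = i
    · subst hn
      simpa using hi.trans (iUnion_mono fun j => hCB j n)
    · simpa [hn] using fun j => (hne j n hn).trans (hCB j n)
  · by_cases hn : n = i
    · simpa [hn] using MeasurableSet.iUnion fun j => hB j i
    · simpa [hn] using MeasurableSet.iInter fun j => hB j n
  · refine eq_empty_of_forall_notMem fun x hx => ?_
    rw [mem_iInter] at hx
    have hxi : x ∈ ⋃ j, B j i := by simpa using hx i
    obtain ⟨j, hj⟩ := mem_iUnion.1 hxi
    have : x ∈ ⋂ n, B j n := mem_iInter.2 fun n => by
      by_cases hn : n = i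
      · exact hn ▸ hj
      · have := hx n
        simp only [hn, if_false] at this
        exact mem_iInter.1 this j
    simp [hBe j] at this

/-- Sequences whose coordinates agree with the `n`-th row of `z` (through the pairing of `ℕ × ℕ`
with `ℕ`) as far as these are among the first `m` entries of `z`. -/
def rowCylinder (n : ℕ) (z : ℕ → ℕ) (m : ℕ) : Set (ℕ → ℕ) :=
  {a | ∀ l, Nat.pair n l < m → a l = z (Nat.pair n l)}

theorem MeasurablyNullSeparable.exists_update {α : Type*} [MeasurableSpace α]
    {f : ℕ → (ℕ → ℕ) → α} {z : ℕ → ℕ} {m : ℕ}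
    (h : ¬ MeasurablyNullSeparable fun n => f n '' rowCylinder n z m) :
    ∃ j, ¬ MeasurablyNullSeparable
      fun n => f n '' rowCylinder n (Function.update z m j) (m + 1) := by
  contrapose! h
  refine MeasurablyNullSeparable.of_cover (Nat.unpair m).1 (fun j n hn => image_mono ?_) ?_ h
  · intro a ha l hl
    have hne : Nat.pair n l ≠ m := by
      rintro rfl
      simp at hn
    rw [Function.update_of_ne hne]
    exact ha l (by omega)
  · rintro _ ⟨a, ha, rfl⟩
    refine mem_iUnion.2 ⟨a (Nat.unpair m).2, a, fun l hl => ?_, rfl⟩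
    by_cases hm : Nat.pair (Nat.unpair m).1 l = m
    · rw [hm, Function.update_self]
      conv_rhs => rw [← hm]
      simp
    · rw [Function.update_of_ne hm]
      exact ha l (by omega)

theorem measurablyNullSeparable_range {α : Type*} [TopologicalSpace α] [T2Space α]
    [MeasurableSpace α] [OpensMeasurableSpace α] {f : ℕ → (ℕ → ℕ) → α}
    (hf : ∀ n, Continuous (f n)) (h : ⋂ n, range (f n) = ∅) :
    MeasurablyNullSeparable fun n => range (f n) := by
  by_contra hsep
  choose! F hF using fun (m : ℕ) (z : ℕ → ℕ) =>
    MeasurablyNullSeparable.exists_update (f := f) (z := z) (m := m)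
  let u : ℕ → ℕ → ℕ := fun m => Nat.rec (fun _ => 0) (fun m z => Function.update z m (F m z)) m
  have hu_succ : ∀ m, u (m + 1) = Function.update (u m) m (F m (u m)) := fun m => rfl
  have hu : ∀ m, ¬ MeasurablyNullSeparable fun n => f n '' rowCylinder n (u m) m := by
    intro m
    induction m with
    | zero =>
      convert hsep using 3 with n
      have : rowCylinder n (u 0) 0 = univ := by simp [rowCylinder]
      rw [this, image_univ]
    | succ m ih => exact hF m (u m) ih
  let z : ℕ → ℕ := fun k => u (k + 1) k
  have hz : ∀ k m, k < m → u m k = z k := by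
    intro k m hkm
    induction m, hkm using Nat.le_induction with
    | base => rfl
    | succ m hm ih => rw [hu_succ, Function.update_of_ne (by omega), ih]
  let a : ℕ → ℕ → ℕ := fun n l => z (Nat.pair n l)
  have hsmall : ∀ n, ∀ U : Set α, IsOpen U → f n (a n) ∈ U →
      ∀ᶠ m in Filter.atTop, f n '' rowCylinder n (u m) m ⊆ U := by
    intro n U hU hn
    have hopen : IsOpen (f n ⁻¹' U) := hU.preimage (hf n)
    obtain ⟨I, V, hV, hIV⟩ := isOpen_pi_iff.1 hopen (a n) hn
    have : ∀ᶠ m in Filter.atTop, ∀ l ∈ I, Nat.pair n l < m :=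
      (Finset.eventually_all I).2 fun l _ => Filter.eventually_gt_atTop _
    filter_upwards [this] with m hm
    rintro _ ⟨b, hb, rfl⟩
    refine hIV fun l hl => ?_
    rw [hb l (hm l hl), hz _ _ (hm l hl)]
    exact (hV l hl).2
  by_cases heq : ∀ i j, f i (a i) = f j (a j)
  · have : f 0 (a 0) ∈ ⋂ n, range (f n) := mem_iInter.2 fun n => ⟨a n, heq n 0⟩
    simp [h] at this
  · push Not at heq
    obtain ⟨i, j, hij⟩ := heq
    have hne : i ≠ j := fun h => hij (h ▸ rfl)
    obtain ⟨U, W, hU, hW, hiU, hjW, hUW⟩ := t2_separation hij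
    obtain ⟨m, hmU, hmW⟩ := ((hsmall i U hU hiU).and (hsmall j W hW hjW)).exists
    refine hu m ⟨fun n => if n = i then U else if n = j then W else univ, fun n => ?_,
      fun n => ?_, ?_⟩
    · dsimp only
      split_ifs with h1 h2
      · exact h1 ▸ hmU
      · exact h2 ▸ hmW
      · exact subset_univ _
    · dsimp only
      split_ifs
      exacts [hU.measurableSet, hW.measurableSet, MeasurableSet.univ]
    · refine eq_empty_of_forall_notMem fun x hx => ?_
      rw [mem_iInter] at hx
      have h1 := hx i
      have h2 := hx j
      simp only [if_true, hne.symm, if_false] at h1 h2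
      exact disjoint_left.1 hUW h1 h2

/-- **Novikov's separation theorem** for sequences of analytic sets. -/
theorem MeasureTheory.AnalyticSet.measurablyNullSeparable {α : Type*} [TopologicalSpace α]
    [T2Space α] [MeasurableSpace α] [OpensMeasurableSpace α] {A : ℕ → Set α}
    (hA : ∀ n, AnalyticSet (A n)) (h : ⋂ n, A n = ∅) : MeasurablyNullSeparable A := by
  by_cases hne : ∃ i, A i = ∅
  · obtain ⟨i, hi⟩ := hne
    refine ⟨fun n => if n = i then ∅ else univ, fun n => ?_, fun n => ?_, ?_⟩
    · dsimp only
      split_ifs with hn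
      · rw [hn, hi]
      · exact subset_univ _
    · dsimp only
      split_ifs
      exacts [MeasurableSet.empty, MeasurableSet.univ]
    · exact eq_empty_of_forall_notMem fun x hx => by simpa using mem_iInter.1 hx i
  · push Not at hne
    have : ∀ n, ∃ f : (ℕ → ℕ) → α, Continuous f ∧ range f = A n := fun n => by
      have hAn := hA n
      rw [AnalyticSet] at hAn
      exact hAn.resolve_left (hne n).ne_empty
    choose f hf hfA using this
    simpa only [hfA] using measurablyNullSeparable_range hf (by simpa only [hfA] using h)

theorem exists_countable_selectors_of_ncard_le {X Y : Type*} [MeasurableSpace X]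
    [StandardBorelSpace X] [MeasurableSpace Y] [StandardBorelSpace Y] [Nonempty Y]
    {P : Set (X × Y)} (hP : MeasurableSet P) (hfin : ∀ x, {y | (x, y) ∈ P}.Finite) (n : ℕ) :
    ∀ C : Set X, MeasurableSet C → (∀ x ∈ C, {y | (x, y) ∈ P}.ncard ≤ n) →
      ∃ 𝓕 : Set (X → Y), 𝓕.Countable ∧ (∀ f ∈ 𝓕, Measurable f) ∧
        ∀ x ∈ C, ∀ y, (x, y) ∈ P → ∃ f ∈ 𝓕, f x = y := by
  induction n with
  | zero =>
    intro C _ hC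
    refine ⟨∅, countable_empty, by simp, fun x hx y hy => ?_⟩
    have := (Set.ncard_eq_zero (hfin x)).1 (Nat.le_zero.1 (hC x hx))
    exact absurd hy (eq_empty_iff_forall_notMem.1 this y)
  | succ n ih =>
    intro C hCm hC
    obtain ⟨ι, hι⟩ := MeasureTheory.exists_measurableEmbedding_real Y
    let T : Set (X × (Fin (n + 1) → Y)) :=
      {q | q.1 ∈ C ∧ (∀ i, (q.1, q.2 i) ∈ P) ∧ ∀ i j, i < j → ι (q.2 i) < ι (q.2 j)}
    have hev : ∀ i : Fin (n + 1), Measurable fun q : X × (Fin (n + 1) → Y) => q.2 i :=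
      fun i => (measurable_pi_apply i).comp measurable_snd
    have hT : MeasurableSet T := by
      refine (measurable_fst hCm).inter (MeasurableSet.inter ?_ ?_)
      · exact measurableSet_setOfPred.2 (Measurable.forall fun i =>
          measurableSet_setOfPred.1 ((measurable_fst.prodMk (hev i)) hP))
      · exact measurableSet_setOfPred.2 (Measurable.forall fun i => Measurable.forall fun j =>
          measurable_const.imp (measurableSet_setOfPred.1
            (measurableSet_lt (hι.measurable.comp (hev i)) (hι.measurable.comp (hev j)))))
    have hinj : ∀ q ∈ T, Function.Injective q.2 := fun q hq =>
      Function.Injective.of_comp (f := ι) (StrictMono.injective fun i j hij => hq.2.2 i j hij)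
    have hrange : ∀ q ∈ T, range q.2 = {y | (q.1, y) ∈ P} := fun q hq => by
      refine Set.eq_of_subset_of_ncard_le (range_subset_iff.2 hq.2.1) ?_ (hfin _)
      rw [← image_univ, Set.ncard_image_of_injective _ (hinj q hq), Set.ncard_univ]
      simpa using hC q.1 hq.1
    let e : T → X := fun q => q.1.1
    have he_inj : Function.Injective e := by
      rintro ⟨⟨x, t⟩, hq⟩ ⟨⟨x', t'⟩, hq'⟩ (rfl : x = x')
      have hr : range t = range t' := (hrange _ hq).trans (hrange _ hq').symm
      have : ι ∘ t = ι ∘ t' := by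
        refine (StrictMono.range_inj (fun i j hij => hq.2.2 i j hij)
          (fun i j hij => hq'.2.2 i j hij)).1 ?_
        change range (ι ∘ t) = range (ι ∘ t')
        rw [range_comp, range_comp, hr]
      have : t = t' := hι.injective.comp_left this
      simp [this]
    have : StandardBorelSpace T := hT.standardBorel
    have he : MeasurableEmbedding e :=
      (measurable_fst.comp measurable_subtype_coe).measurableEmbedding he_inj
    have hD : MeasurableSet (range e) := he.measurableSet_range
    obtain ⟨𝓕, h𝓕c, h𝓕m, h𝓕⟩ := ih (C \ range e) (hCm.diff hD) fun x hx => by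
      by_contra! hlt
      refine hx.2 ?_
      have hcard : ((hfin x).toFinset.map ⟨ι, hι.injective⟩).card = n + 1 := by
        rw [Finset.card_map, ← Set.ncard_eq_toFinset_card _ (hfin x)]
        exact le_antisymm (hC x hx.1) hlt
      have hpre : ∀ i, ∃ y, (x, y) ∈ P ∧ ι y = Finset.orderEmbOfFin _ hcard i := fun i => by
        obtain ⟨y, hy, hyi⟩ := Finset.mem_map.1 (Finset.orderEmbOfFin_mem _ hcard i)
        exact ⟨y, (hfin x).mem_toFinset.1 hy, hyi⟩
      choose t htP ht using hpre
      refine ⟨⟨(x, t), hx.1, htP, fun i j hij => ?_⟩, rfl⟩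
      simp only [ht]
      exact (Finset.orderEmbOfFin _ hcard).strictMono hij
    obtain ⟨y₀⟩ := ‹Nonempty Y›
    refine ⟨𝓕 ∪ range fun i : Fin (n + 1) =>
      Function.extend e (fun q : T => q.1.2 i) fun _ => y₀,
      h𝓕c.union (countable_range _), ?_, fun x hx y hy => ?_⟩
    · rintro f (hf | ⟨i, rfl⟩)
      · exact h𝓕m f hf
      · exact he.measurable_extend ((hev i).comp measurable_subtype_coe) measurable_const
    · by_cases hxe : x ∈ range e
      · obtain ⟨q, rfl⟩ := hxe
        have hyr : y ∈ range q.1.2 := by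
          rw [hrange q.1 q.2]
          exact hy
        obtain ⟨i, rfl⟩ := hyr
        exact ⟨_, Or.inr ⟨i, rfl⟩, he_inj.extend_apply _ _ _⟩
      · obtain ⟨f, hf, hfx⟩ := h𝓕 x ⟨hx, hxe⟩ y hy
        exact ⟨f, Or.inl hf, hfx⟩

theorem analyticSet_le_ncard_section {X Y : Type*} [TopologicalSpace X] [PolishSpace X]
    [MeasurableSpace X] [BorelSpace X] [TopologicalSpace Y] [PolishSpace Y]
    [MeasurableSpace Y] [BorelSpace Y] {P : Set (X × Y)} (hP : MeasurableSet P)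
    (hfin : ∀ x, {y | (x, y) ∈ P}.Finite) (n : ℕ) :
    MeasureTheory.AnalyticSet {x | n ≤ {y | (x, y) ∈ P}.ncard} := by
  let T : Set (X × (Fin n → Y)) :=
    {q | (∀ i, (q.1, q.2 i) ∈ P) ∧ ∀ i j, q.2 i = q.2 j → i = j}
  have hev : ∀ i : Fin n, Measurable fun q : X × (Fin n → Y) => q.2 i :=
    fun i => (measurable_pi_apply i).comp measurable_snd
  have hT : MeasurableSet T := by
    refine MeasurableSet.inter ?_ ?_
    · exact measurableSet_setOfPred.2 (Measurable.forall fun i =>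
        measurableSet_setOfPred.1 ((measurable_fst.prodMk (hev i)) hP))
    · exact measurableSet_setOfPred.2 (Measurable.forall fun i => Measurable.forall fun j =>
        (measurableSet_setOfPred.1 (measurableSet_eq_fun (hev i) (hev j))).imp measurable_const)
  convert hT.analyticSet.image_of_continuous continuous_fst using 1
  ext x
  constructor
  · intro hx
    obtain ⟨s, hs, hcard⟩ := Set.exists_subset_card_eq (show n ≤ _ from hx)
    have hsf : s.Finite := (hfin x).subset hs
    have : Finite s := hsf
    let φ : Fin n ≃ s := (Finite.equivFinOfCardEq hcard).symm
    exact ⟨(x, fun i => φ i), ⟨fun i => hs (φ i).2,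
      fun i j hij => φ.injective (Subtype.ext hij)⟩, rfl⟩
  · rintro ⟨⟨x, t⟩, ⟨ht, hinj⟩, rfl⟩
    have h1 : (range t).ncard = n := by
      rw [← image_univ, Set.ncard_image_of_injective _ fun i j => hinj i j, Set.ncard_univ]
      simp
    rw [mem_ofPred_eq]
    conv_lhs => rw [← h1]
    exact Set.ncard_le_ncard (range_subset_iff.2 ht) (hfin _)

/-- A Borel set with finite sections is covered by the graphs of countably many Borel functions
(the finite-section case of the **Lusin–Novikov theorem**). -/
theorem exists_countable_selectors {X Y : Type*} [TopologicalSpace X] [PolishSpace X]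
    [MeasurableSpace X] [BorelSpace X] [TopologicalSpace Y] [PolishSpace Y]
    [MeasurableSpace Y] [BorelSpace Y] [Nonempty Y] {P : Set (X × Y)} (hP : MeasurableSet P)
    (hfin : ∀ x, {y | (x, y) ∈ P}.Finite) :
    ∃ 𝓕 : Set (X → Y), 𝓕.Countable ∧ (∀ f ∈ 𝓕, Measurable f) ∧
      ∀ x y, (x, y) ∈ P → ∃ f ∈ 𝓕, f x = y := by
  obtain ⟨B, hAB, hB, hBe⟩ := MeasureTheory.AnalyticSet.measurablyNullSeparable
    (analyticSet_le_ncard_section hP hfin) <| eq_empty_of_forall_notMem fun x hx => by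
      have := mem_iInter.1 hx ({y | (x, y) ∈ P}.ncard + 1)
      simp at this
  choose 𝓕 h𝓕c h𝓕m h𝓕 using fun n => exists_countable_selectors_of_ncard_le hP hfin n (B n)ᶜ
    (hB n).compl fun x hx => by
      by_contra! hlt
      exact hx (hAB n hlt.le)
  refine ⟨⋃ n, 𝓕 n, countable_iUnion h𝓕c, fun f hf => ?_, fun x y hxy => ?_⟩
  · obtain ⟨n, hn⟩ := mem_iUnion.1 hf
    exact h𝓕m n f hn
  · have hx : x ∉ ⋂ n, B n := by simp [hBe]
    rw [mem_iInter] at hx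
    push Not at hx
    obtain ⟨n, hn⟩ := hx
    obtain ⟨f, hf, hfx⟩ := h𝓕 n x hn y hxy
    exact ⟨f, mem_iUnion.2 ⟨n, hf⟩, hfx⟩

/-- A locally finite Borel graph is generated by countably many Borel maps that send every vertex
to itself or to a neighbor. -/
theorem exists_measurable_moves {V : Type*} [TopologicalSpace V] [PolishSpace V]
    [MeasurableSpace V] [BorelSpace V] {G : SimpleGraph V}
    (hG : MeasurableSet {p : V × V | G.Adj p.1 p.2}) (hLF : ∀ v, (G.neighborSet v).Finite) :
    ∃ g : ℕ → V → V, (∀ k, Measurable (g k)) ∧ (∀ k x, g k x = x ∨ G.Adj x (g k x)) ∧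
      ∀ x y, G.Adj x y → ∃ k, g k x = y := by
  classical
  rcases isEmpty_or_nonempty V with hV | hV
  · exact ⟨fun _ => id, fun _ => measurable_id, fun _ x => (hV.false x).elim,
      fun x => (hV.false x).elim⟩
  obtain ⟨𝓕, hc, hm, h𝓕⟩ := exists_countable_selectors hG hLF
  obtain ⟨f, hf⟩ := (hc.insert id).exists_eq_range (insert_nonempty _ _)
  have hfm : ∀ k, Measurable (f k) := fun k => by
    have : f k ∈ insert id 𝓕 := hf ▸ mem_range_self k
    rcases this with h | h
    · exact h ▸ measurable_id
    · exact hm _ h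
  refine ⟨fun k x => if G.Adj x (f k x) then f k x else x, fun k => ?_, fun k x => ?_,
    fun x y hxy => ?_⟩
  · exact Measurable.ite ((measurable_id.prodMk (hfm k)) hG) (hfm k) measurable_id
  · dsimp only
    split_ifs with h
    exacts [Or.inr h, Or.inl rfl]
  · obtain ⟨φ, hφ, rfl⟩ := h𝓕 x y hxy
    have : φ ∈ range f := hf ▸ mem_insert_of_mem _ hφ
    obtain ⟨k, rfl⟩ := this
    exact ⟨k, if_pos hxy⟩

namespace SimpleGraph

variable {V : Type*}

/-- The set of vertices adjacent to some vertex of `F`. -/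
def nbhd (G : SimpleGraph V) (F : Set V) : Set V := ⋃ x ∈ F, G.neighborSet x

theorem mem_nbhd {G : SimpleGraph V} {F : Set V} {y : V} :
    y ∈ G.nbhd F ↔ ∃ x ∈ F, G.Adj x y := by
  simp [nbhd]

theorem finite_nbhd {G : SimpleGraph V} (hLF : ∀ v, (G.neighborSet v).Finite) {F : Set V}
    (hF : F.Finite) : (G.nbhd F).Finite :=
  hF.biUnion fun v _ => hLF v

/-- Hall's condition for the graph obtained from `G` by deleting the vertices in `R`. -/
def HallOff (G : SimpleGraph V) (R : Set V) : Prop :=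
  ∀ F : Set V, F.Finite → Disjoint F R → F.ncard ≤ (G.nbhd F \ R).ncard

/-- Two vertices of `F` are linked when they have a common neighbor in `G`. -/
def linkGraph (G : SimpleGraph V) (F : Set V) : SimpleGraph V where
  Adj a b := a ≠ b ∧ a ∈ F ∧ b ∈ F ∧ ∃ c, G.Adj a c ∧ G.Adj b c
  symm := ⟨fun _ _ ⟨hne, ha, hb, c, hac, hbc⟩ => ⟨hne.symm, hb, ha, c, hbc, hac⟩⟩
  loopless := ⟨fun _ h => h.1 rfl⟩

/-- `F` is connected through common neighbors. -/
def Linked (G : SimpleGraph V) (F : Set V) : Prop :=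
  ∀ a ∈ F, ∀ b ∈ F, (G.linkGraph F).Reachable a b

theorem Walk.exists_of_linkGraph {G : SimpleGraph V} {F : Set V} {a b : V}
    (p : (G.linkGraph F).Walk a b) : ∃ q : G.Walk a b, q.length = 2 * p.length := by
  induction p with
  | nil => exact ⟨.nil, rfl⟩
  | cons h p ih =>
    obtain ⟨q, hq⟩ := ih
    obtain ⟨c, hac, hbc⟩ := h.2.2.2
    refine ⟨.cons hac (.cons hbc.symm q), ?_⟩
    rw [Walk.length_cons, Walk.length_cons, Walk.length_cons, hq]
    ring

theorem mem_of_linkGraph_walk {G : SimpleGraph V} {F : Set V} {a b : V}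
    (p : (G.linkGraph F).Walk a b) (ha : a ∈ F) : b ∈ F := by
  induction p with
  | nil => exact ha
  | cons h p ih => exact ih h.2.2.1

theorem Linked.subset_or_subset {G : SimpleGraph V} {B₀ B₁ F : Set V}
    (hunion : B₀ ∪ B₁ = univ) (hbip : ∀ x y, G.Adj x y → (x ∈ B₀ ↔ y ∈ B₁))
    (hF : G.Linked F) : F ⊆ B₀ ∨ F ⊆ B₁ := by
  have key : ∀ a b, (G.linkGraph F).Walk a b → (a ∈ B₀ ↔ b ∈ B₀) := by
    intro a b p
    induction p with
    | nil => rfl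
    | cons h p ih =>
      obtain ⟨-, -, -, c, hac, hbc⟩ := h
      rw [← ih, hbip _ _ hac, hbip _ _ hbc]
  by_cases h : F ⊆ B₀
  · exact Or.inl h
  · obtain ⟨a, haF, ha⟩ := not_subset.1 h
    refine Or.inr fun b hb => ?_
    obtain ⟨p⟩ := hF a haF b hb
    have : b ∉ B₀ := fun hb₀ => ha ((key a b p).2 hb₀)
    exact (hunion.ge (mem_univ b)).resolve_left this

theorem HallOff.of_linked {G : SimpleGraph V} (hLF : ∀ v, (G.neighborSet v).Finite) {R : Set V}
    (h : ∀ F : Set V, F.Finite → G.Linked F → Disjoint F R →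
      F.ncard ≤ (G.nbhd F \ R).ncard) : G.HallOff R := by
  intro F hF
  induction hn : F.ncard using Nat.strong_induction_on generalizing F with
  | _ n ih =>
  subst hn
  intro hFR
  by_cases hl : G.Linked F
  · exact h F hF hl hFR
  simp only [Linked, not_forall] at hl
  obtain ⟨a, ha, b, hb, hab⟩ := hl
  let F₁ : Set V := {v | v ∈ F ∧ (G.linkGraph F).Reachable a v}
  let F₂ : Set V := {v | v ∈ F ∧ ¬ (G.linkGraph F).Reachable a v}
  have hF₁ : F₁ ⊆ F := fun v hv => hv.1
  have hF₂ : F₂ ⊆ F := fun v hv => hv.1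
  have hU : F₁ ∪ F₂ = F := by
    ext v
    simp only [F₁, F₂, mem_union, mem_ofPred_eq]
    tauto
  have hd : Disjoint F₁ F₂ := Set.disjoint_left.2 fun v hv hv' => hv'.2 hv.2
  have hcard : F₁.ncard + F₂.ncard = F.ncard := by
    rw [← ncard_union_eq hd (hF.subset hF₁) (hF.subset hF₂), hU]
  have hdN : Disjoint (G.nbhd F₁) (G.nbhd F₂) := Set.disjoint_left.2 fun c h₁ h₂ => by
    obtain ⟨u, hu, huc⟩ := mem_nbhd.1 h₁
    obtain ⟨v, hv, hvc⟩ := mem_nbhd.1 h₂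
    refine hv.2 (hu.2.trans (Adj.reachable ⟨?_, hu.1, hv.1, c, huc, hvc⟩))
    rintro rfl
    exact hv.2 hu.2
  have hN : G.nbhd F = G.nbhd F₁ ∪ G.nbhd F₂ := by
    rw [← hU, nbhd, biUnion_union]
    rfl
  have h1 : 0 < F₁.ncard := (ncard_pos (hF.subset hF₁)).2 ⟨a, ha, .rfl⟩
  have h2 : 0 < F₂.ncard := (ncard_pos (hF.subset hF₂)).2 ⟨b, hb, hab⟩
  have i1 := ih F₁.ncard (by omega) F₁ (hF.subset hF₁) rfl (hFR.mono_left hF₁)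
  have i2 := ih F₂.ncard (by omega) F₂ (hF.subset hF₂) rfl (hFR.mono_left hF₂)
  rw [hN, union_sdiff_distrib, ncard_union_eq (hdN.mono sdiff_subset sdiff_subset)
    (finite_nbhd hLF (hF.subset hF₁)).sdiff (finite_nbhd hLF (hF.subset hF₂)).sdiff]
  omega

theorem HallOff.exists_partner {G : SimpleGraph V} (hLF : ∀ v, (G.neighborSet v).Finite)
    {B₀ B₁ R : Set V} (hG : G.IsBipartiteWith B₀ B₁) (h : G.HallOff R) {x : V} (hx : x ∉ R) :
    ∃ y, G.Adj x y ∧ y ∉ R ∧ G.HallOff (R ∪ {x, y}) := by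
  classical
  let H : SimpleGraph ↥Rᶜ := G.induce Rᶜ
  have hHfin : ∀ v, (H.neighborSet v).Finite := fun v =>
    (hLF v.1).preimage Subtype.val_injective.injOn
  let _ : H.LocallyFinite := fun v => (hHfin v).fintype
  have hHbip : H.IsBipartiteWith (Subtype.val ⁻¹' B₀) (Subtype.val ⁻¹' B₁) :=
    ⟨hG.disjoint.preimage _, fun v w hvw => hG.mem_of_adj hvw⟩
  obtain ⟨M, hM, hMs⟩ := exists_isPerfectMatching_of_forall_ncard_le hHbip fun s => by
    rcases s.finite_or_infinite with hs | hs
    · have := h (Subtype.val '' s) (hs.image _) (Set.disjoint_left.2 (by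
        rintro _ ⟨v, -, rfl⟩
        exact v.2))
      rw [ncard_image_of_injective _ Subtype.val_injective] at this
      refine this.trans_eq ?_
      rw [← ncard_image_of_injective (⋃ x ∈ s, H.neighborSet x) Subtype.val_injective]
      congr 1
      ext y
      simp only [mem_sdiff, mem_nbhd, mem_image, mem_iUnion]
      constructor
      · rintro ⟨⟨_, ⟨v, hv, rfl⟩, hvy⟩, hy⟩
        exact ⟨⟨y, hy⟩, ⟨v, hv, hvy⟩, rfl⟩
      · rintro ⟨w, ⟨v, hv, hvw⟩, rfl⟩
        exact ⟨⟨v, ⟨v, hv, rfl⟩, hvw⟩, w.2⟩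
    · simp [hs.ncard]
  choose m hm hm' using fun v => hM (hMs v)
  have hmm : ∀ v, m (m v) = v := fun v => (hm' (m v) v (hm v).symm).symm
  have hmG : ∀ v, G.Adj v.1 (m v).1 := fun v => M.adj_sub (hm v)
  refine ⟨m ⟨x, hx⟩, hmG ⟨x, hx⟩, (m ⟨x, hx⟩).2, fun F hF hFR => ?_⟩
  let f : V → V := fun v => if hv : v ∈ R then v else (m ⟨v, hv⟩).1
  have hFR' : ∀ v ∈ F, v ∉ R := fun v hv hvR => Set.disjoint_left.1 hFR hv (Or.inl hvR)
  refine ncard_le_ncard_of_injOn f (fun v hv => ?_) (fun v hv w hw hvw => ?_)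
    (finite_nbhd hLF hF).sdiff
  · have hvR := hFR' v hv
    simp only [f, hvR, dif_neg, not_false_eq_true]
    refine ⟨mem_nbhd.2 ⟨v, hv, hmG ⟨v, hvR⟩⟩, ?_⟩
    rintro (h1 | h1 | h1)
    · exact (m ⟨v, hvR⟩).2 h1
    · refine Set.disjoint_left.1 hFR hv (Or.inr (Or.inr ?_))
      have : m ⟨v, hvR⟩ = ⟨x, hx⟩ := Subtype.ext h1
      rw [mem_singleton_iff, ← this, hmm]
    · refine Set.disjoint_left.1 hFR hv (Or.inr (Or.inl ?_))
      have : m ⟨v, hvR⟩ = m ⟨x, hx⟩ := Subtype.ext h1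
      have := congrArg m this
      rw [hmm, hmm] at this
      exact congrArg Subtype.val this
  · simp only [f, hFR' v hv, hFR' w hw, dif_neg, not_false_eq_true] at hvw
    have := congrArg m (Subtype.ext hvw)
    rw [hmm, hmm] at this
    exact congrArg Subtype.val this

theorem ncard_mul_le_of_walk_length {H : SimpleGraph V} {F : Set V} (hF : F.Finite)
    (hmem : ∀ a ∈ F, ∀ b, H.Reachable a b → b ∈ F) (hreach : ∀ a ∈ F, ∀ b ∈ F, H.Reachable a b)
    {ι : Type*} {s : Set ι} {a : ι → V} (ha : ∀ i ∈ s, a i ∈ F) {L : ℕ}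
    (hsep : ∀ i ∈ s, ∀ j ∈ s, ∀ p : H.Walk (a i) (a j), p.length < 2 * L → i = j)
    (hs : s.Nontrivial ∨ L ≤ F.ncard) : s.ncard * L ≤ F.ncard := by
  by_cases hnt : s.Nontrivial
  · have : ∀ q : ι × ℕ, ∃ v, q ∈ s ×ˢ Iio L →
        v ∈ F ∧ H.Reachable (a q.1) v ∧ H.dist (a q.1) v = q.2 := by
      rintro ⟨i, k⟩
      by_cases hi : i ∈ s ∧ k < L
      · obtain ⟨j, hj, hji⟩ := hnt.exists_ne i
        obtain ⟨p, hp⟩ := (hreach _ (ha i hi.1) _ (ha j hj)).exists_walk_length_eq_dist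
        have hle : 2 * L ≤ p.length := by
          by_contra! hlt
          exact hji (hsep i hi.1 j hj p hlt).symm
        refine ⟨p.getVert k, fun _ => ⟨hmem _ (ha i hi.1) _ (p.take k).reachable,
          (p.take k).reachable, ?_⟩⟩
        rw [← length_eq_dist_of_subwalk hp (p.isSubwalk_take k), Walk.take_length]
        have := hi.2
        dsimp only
        omega
      · exact ⟨a i, fun h => absurd h hi⟩
    choose v hv using this
    have hcard : (s ×ˢ Iio L).ncard = s.ncard * L := by
      rw [ncard_prod]
      congr 1
      rw [← Finset.coe_Iio, ncard_coe_finset, Nat.card_Iio]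
    rw [← hcard]
    refine ncard_le_ncard_of_injOn v (fun q hq => (hv q hq).1) ?_ hF
    rintro ⟨i, k⟩ hq ⟨j, l⟩ hq' heq
    obtain ⟨-, hr, hd⟩ := hv _ hq
    obtain ⟨-, hr', hd'⟩ := hv _ hq'
    have hk : k < L := hq.2
    have hl : l < L := hq'.2
    rw [← heq] at hr' hd'
    dsimp only at hr hr' hd hd'
    obtain ⟨p, hp⟩ := hr.exists_walk_length_eq_dist
    obtain ⟨p', hp'⟩ := hr'.exists_walk_length_eq_dist
    have hij : i = j := hsep i hq.1 j hq'.1 (p.append p'.reverse) (by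
      rw [Walk.length_append, Walk.length_reverse, hp, hp', hd, hd']
      omega)
    subst hij
    rw [← hd, ← hd']
  · have hsub := not_nontrivial_iff.1 hnt
    have : s.ncard ≤ 1 := (ncard_le_one hsub.finite).2 fun x hx y hy => hsub hx hy
    calc s.ncard * L ≤ 1 * L := Nat.mul_le_mul_right _ this
      _ ≤ F.ncard := by simpa using hs.resolve_left hnt

/-- A set of edges `{x, p x}`, `x ∈ E`, that are pairwise far apart and each of which can be
removed together with `R` without violating Hall's condition. -/
structure IsStage (G : SimpleGraph V) (R E : Set V) (p : V → V) (L : ℕ) : Prop where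
  eq_of_walk : ∀ x ∈ E, ∀ y ∈ E, ∀ w : G.Walk x y, w.length ≤ 4 * L + 2 → x = y
  adj : ∀ x ∈ E, G.Adj x (p x)
  notMem : ∀ x ∈ E, x ∉ R
  partner_notMem : ∀ x ∈ E, p x ∉ R
  hallOff : ∀ x ∈ E, G.HallOff (R ∪ {x, p x})

/-- The set `R` occupies at most a proportion `δ` of the neighborhood of large linked sets. -/
def IsRare (G : SimpleGraph V) (R : Set V) (L : ℕ) (δ : ℝ) : Prop :=
  ∀ F : Set V, F.Finite → G.Linked F → L ≤ F.ncard → ((G.nbhd F ∩ R).ncard : ℝ) ≤ δ * F.ncard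

theorem IsStage.ncard_mul_le {G : SimpleGraph V} {R E : Set V} {p : V → V} {L : ℕ}
    (h : G.IsStage R E p L) {F : Set V} (hF : F.Finite) (hl : G.Linked F) {X : Set V}
    (hX : ∀ x ∈ X, x ∈ E ∧ (x ∈ G.nbhd F ∨ p x ∈ G.nbhd F))
    (hs : X.Nontrivial ∨ L ≤ F.ncard) : X.ncard * L ≤ F.ncard := by
  have : ∀ x, ∃ a, x ∈ X → a ∈ F ∧ ∃ w : G.Walk x a, w.length ≤ 2 := by
    intro x
    by_cases hx : x ∈ X
    · obtain ⟨hxE, hxN⟩ := hX x hx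
      rcases hxN with hN | hN
      · obtain ⟨a, ha, hax⟩ := mem_nbhd.1 hN
        exact ⟨a, fun _ => ⟨ha, .cons hax.symm .nil, by simp⟩⟩
      · obtain ⟨a, ha, hax⟩ := mem_nbhd.1 hN
        exact ⟨a, fun _ => ⟨ha, .cons (h.adj x hxE) (.cons hax.symm .nil), by simp⟩⟩
    · exact ⟨x, fun hx' => absurd hx' hx⟩
  choose a ha using this
  refine ncard_mul_le_of_walk_length (H := G.linkGraph F) hF
    (fun b hb c ⟨q⟩ => mem_of_linkGraph_walk q hb) hl (fun x hx => (ha x hx).1)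
    (fun x hx y hy q hq => ?_) hs
  obtain ⟨q', hq'⟩ := Walk.exists_of_linkGraph q
  obtain ⟨w, hw⟩ := (ha x hx).2
  obtain ⟨w', hw'⟩ := (ha y hy).2
  refine h.eq_of_walk x (hX x hx).1 y (hX y hy).1 (w.append (q'.append w'.reverse)) ?_
  rw [Walk.length_append, Walk.length_append, Walk.length_reverse]
  omega

theorem IsStage.ncard_inter_mul_le {G : SimpleGraph V} (hLF : ∀ v, (G.neighborSet v).Finite)
    {R E : Set V} {p : V → V} {L : ℕ} (h : G.IsStage R E p L) {F : Set V} (hF : F.Finite)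
    (hl : G.Linked F) (hLF' : L ≤ F.ncard) :
    (G.nbhd F ∩ (E ∪ p '' E)).ncard * L ≤ 2 * F.ncard := by
  let X : Set V := {x | x ∈ E ∧ (x ∈ G.nbhd F ∨ p x ∈ G.nbhd F)}
  have hfin : X.Finite := by
    refine ((finite_nbhd hLF hF).union (finite_nbhd hLF (finite_nbhd hLF hF))).subset ?_
    rintro x ⟨hxE, hx | hx⟩
    · exact Or.inl hx
    · exact Or.inr (mem_nbhd.2 ⟨p x, hx, (h.adj x hxE).symm⟩)
  have hsub : G.nbhd F ∩ (E ∪ p '' E) ⊆ X ∪ p '' X := by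
    rintro y ⟨hy, hyE | ⟨x, hxE, rfl⟩⟩
    · exact Or.inl ⟨hyE, Or.inl hy⟩
    · exact Or.inr ⟨x, ⟨hxE, Or.inr hy⟩, rfl⟩
  have h1 := ncard_le_ncard hsub (hfin.union (hfin.image p))
  have h2 := ncard_union_le X (p '' X)
  have h3 := ncard_image_le (f := p) hfin
  have h4 := h.ncard_mul_le hF hl (X := X) (fun x hx => hx) (Or.inr hLF')
  nlinarith

theorem IsStage.ncard_le_of_lt {G : SimpleGraph V} (hLF : ∀ v, (G.neighborSet v).Finite)
    {R E : Set V} {p : V → V} {L : ℕ} (h : G.IsStage R E p L) (hR : G.HallOff R) {F : Set V}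
    (hF : F.Finite) (hl : G.Linked F) (hFL : F.ncard < L)
    (hd : Disjoint F (R ∪ (E ∪ p '' E))) :
    F.ncard ≤ (G.nbhd F \ (R ∪ (E ∪ p '' E))).ncard := by
  let X : Set V := {x | x ∈ E ∧ (x ∈ G.nbhd F ∨ p x ∈ G.nbhd F)}
  have hsub : X.Subsingleton := by
    rw [← not_nontrivial_iff]
    intro hnt
    have h1 := h.ncard_mul_le hF hl (X := X) (fun x hx => hx) (Or.inl hnt)
    have hfin : X.Finite := by
      refine ((finite_nbhd hLF hF).union (finite_nbhd hLF (finite_nbhd hLF hF))).subset ?_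
      rintro x ⟨hxE, hx | hx⟩
      · exact Or.inl hx
      · exact Or.inr (mem_nbhd.2 ⟨p x, hx, (h.adj x hxE).symm⟩)
    have h2 : 0 < X.ncard := (ncard_pos hfin).2 hnt.nonempty
    nlinarith
  rcases X.eq_empty_or_nonempty with hX | ⟨x, hx⟩
  · refine (hR F hF (hd.mono_right subset_union_left)).trans
      (ncard_le_ncard ?_ (finite_nbhd hLF hF).sdiff)
    rintro y ⟨hy, hyR⟩
    refine ⟨hy, ?_⟩
    rintro (h1 | h1 | ⟨x, hxE, rfl⟩)
    · exact hyR h1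
    · exact hX.le (show y ∈ X from ⟨h1, Or.inl hy⟩)
    · exact hX.le (show x ∈ X from ⟨hxE, Or.inr hy⟩)
  · refine (h.hallOff x hx.1 F hF (hd.mono_right ?_)).trans
      (ncard_le_ncard ?_ (finite_nbhd hLF hF).sdiff)
    · rintro y (hy | rfl | rfl)
      · exact Or.inl hy
      · exact Or.inr (Or.inl hx.1)
      · exact Or.inr (Or.inr ⟨x, hx.1, rfl⟩)
    · rintro y ⟨hy, hyR⟩
      refine ⟨hy, ?_⟩
      rintro (h1 | h1 | ⟨z, hzE, rfl⟩)
      · exact hyR (Or.inl h1)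
      · exact hyR (Or.inr (Or.inl (hsub ⟨h1, Or.inl hy⟩ hx)))
      · exact hyR (Or.inr (Or.inr (congrArg p (hsub ⟨hzE, Or.inr hy⟩ hx))))

theorem IsStage.isRare_union {G : SimpleGraph V} (hLF : ∀ v, (G.neighborSet v).Finite)
    {R E : Set V} {p : V → V} {L L' : ℕ} {δ : ℝ} (h : G.IsStage R E p L')
    (hrare : G.IsRare R L δ) (hLL : L ≤ L') (hL' : 0 < L') :
    G.IsRare (R ∪ (E ∪ p '' E)) L' (δ + 2 / L') := by
  intro F hF hl hFL
  have h1 := hrare F hF hl (hLL.trans hFL)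
  have h2 := h.ncard_inter_mul_le hLF hF hl hFL
  have h3 := ncard_union_le (G.nbhd F ∩ R) (G.nbhd F ∩ (E ∪ p '' E))
  rw [← inter_union_distrib_left] at h3
  have hpos : (0 : ℝ) < L' := by exact_mod_cast hL'
  have h4 : ((G.nbhd F ∩ (E ∪ p '' E)).ncard : ℝ) ≤ 2 / L' * F.ncard := by
    rw [div_mul_eq_mul_div, le_div_iff₀ hpos]
    exact_mod_cast h2
  have h5 : ((G.nbhd F ∩ (R ∪ (E ∪ p '' E))).ncard : ℝ) ≤
      (G.nbhd F ∩ R).ncard + (G.nbhd F ∩ (E ∪ p '' E)).ncard := by exact_mod_cast h3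
  linarith

theorem IsStage.hallOff_union {G : SimpleGraph V} (hLF : ∀ v, (G.neighborSet v).Finite)
    {ε : ℝ} (hexp : ∀ F : Set V, F.Finite → G.Linked F →
      (1 + ε) * F.ncard ≤ ((G.nbhd F).ncard : ℝ))
    {R E : Set V} {p : V → V} {L L' : ℕ} {δ : ℝ} (h : G.IsStage R E p L')
    (hR : G.HallOff R) (hrare : G.IsRare R L δ) (hLL : L ≤ L') (hL' : 0 < L')
    (hδ : δ + 2 / L' ≤ ε) : G.HallOff (R ∪ (E ∪ p '' E)) := by
  refine HallOff.of_linked hLF fun F hF hl hd => ?_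
  rcases lt_or_ge F.ncard L' with hFL | hFL
  · exact h.ncard_le_of_lt hLF hR hF hl hFL hd
  · have h1 := h.isRare_union hLF hrare hLL hL' F hF hl hFL
    have h2 := ncard_inter_add_ncard_sdiff_eq_ncard (G.nbhd F) (R ∪ (E ∪ p '' E))
      (finite_nbhd hLF hF)
    have h3 := hexp F hF hl
    rw [← h2] at h3
    push_cast at h3
    have h4 : (δ + 2 / L') * F.ncard ≤ ε * F.ncard :=
      mul_le_mul_of_nonneg_right hδ (Nat.cast_nonneg _)
    have : (F.ncard : ℝ) ≤ (G.nbhd F \ (R ∪ (E ∪ p '' E))).ncard := by linarith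
    exact_mod_cast this

/-- Maps that move every vertex to itself or to a neighbor and that together reach every
neighbor of every vertex. -/
structure IsMoves (G : SimpleGraph V) (g : ℕ → V → V) : Prop where
  eq_or_adj : ∀ k x, g k x = x ∨ G.Adj x (g k x)
  exists_eq : ∀ x y, G.Adj x y → ∃ k, g k x = y

/-- Apply the moves listed in the word `w` successively to `x`. -/
def wordAct (g : ℕ → V → V) (w : List ℕ) (x : V) : V := w.foldl (fun y k => g k y) x

@[simp] theorem wordAct_nil (g : ℕ → V → V) (x : V) : wordAct g [] x = x := rfl

@[simp] theorem wordAct_cons (g : ℕ → V → V) (k : ℕ) (w : List ℕ) (x : V) :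
    wordAct g (k :: w) x = wordAct g w (g k x) := rfl

theorem wordAct_append (g : ℕ → V → V) (v w : List ℕ) (x : V) :
    wordAct g (v ++ w) x = wordAct g w (wordAct g v x) := by
  simp [wordAct, List.foldl_append]

theorem measurable_wordAct [MeasurableSpace V] {g : ℕ → V → V} (hg : ∀ k, Measurable (g k))
    (w : List ℕ) : Measurable (wordAct g w) := by
  induction w with
  | nil => exact measurable_id
  | cons k w ih => exact ih.comp (hg k)

theorem IsMoves.reachable {G : SimpleGraph V} {g : ℕ → V → V} (h : G.IsMoves g) (w : List ℕ)
    (x : V) : G.Reachable x (wordAct g w x) := by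
  induction w generalizing x with
  | nil => exact .rfl
  | cons k w ih =>
    rw [wordAct_cons]
    rcases h.eq_or_adj k x with hk | hk
    · rw [hk]
      exact ih x
    · exact hk.reachable.trans (ih _)

theorem IsMoves.exists_wordAct_of_walk {G : SimpleGraph V} {g : ℕ → V → V} (h : G.IsMoves g)
    {x y : V} (q : G.Walk x y) : ∃ w : List ℕ, w.length = q.length ∧ wordAct g w x = y := by
  induction q with
  | nil => exact ⟨[], rfl, rfl⟩
  | cons hxy q ih =>
    obtain ⟨w, hw, hw'⟩ := ih
    obtain ⟨k, hk⟩ := h.exists_eq _ _ hxy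
    exact ⟨k :: w, by simp [hw], by rw [wordAct_cons, hk, hw']⟩

theorem IsMoves.exists_wordAct {G : SimpleGraph V} {g : ℕ → V → V} (h : G.IsMoves g)
    {x y : V} (hxy : G.Reachable x y) : ∃ w : List ℕ, wordAct g w x = y := by
  obtain ⟨q⟩ := hxy
  obtain ⟨w, -, hw⟩ := h.exists_wordAct_of_walk q
  exact ⟨w, hw⟩

theorem IsMoves.finite_wordAct {G : SimpleGraph V} {g : ℕ → V → V} (h : G.IsMoves g)
    (hLF : ∀ v, (G.neighborSet v).Finite) (D : ℕ) (x : V) :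
    {y | ∃ w : List ℕ, w.length ≤ D ∧ wordAct g w x = y}.Finite := by
  induction D generalizing x with
  | zero =>
    refine (finite_singleton x).subset ?_
    rintro y ⟨w, hw, rfl⟩
    rw [List.length_eq_zero_iff.1 (Nat.le_zero.1 hw)]
    rfl
  | succ D ih =>
    refine (((hLF x).insert x).biUnion fun z _ => ih z).subset ?_
    rintro y ⟨w, hw, rfl⟩
    rw [mem_iUnion₂]
    match w with
    | [] => exact ⟨x, mem_insert _ _, [], by simp, rfl⟩
    | k :: w => exact ⟨g k x, h.eq_or_adj k x, w, by simpa using hw, rfl⟩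

theorem IsMoves.hallOff_iff {G : SimpleGraph V} {g : ℕ → V → V} (h : G.IsMoves g)
    (hLF : ∀ v, (G.neighborSet v).Finite) {R : Set V} (hR : G.HallOff R) {x y : V}
    (hxy : G.Reachable x y) : G.HallOff (R ∪ {x, y}) ↔ ∀ T : Finset (List ℕ),
      (∀ w ∈ T, wordAct g w x ∉ R ∪ {x, y}) → ∃ φ : T → List ℕ,
        (∀ w : T, (∃ w' : T, G.Adj (wordAct g w' x) (wordAct g (φ w) x)) ∧
          wordAct g (φ w) x ∉ R ∪ {x, y}) ∧
        ∀ w v : T, wordAct g (φ w) x = wordAct g (φ v) x → wordAct g w x = wordAct g v x := by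
  constructor
  · intro hH T hT
    have hfin : ((wordAct g · x) '' (T : Set (List ℕ))).Finite := T.finite_toSet.image _
    have hle := hH _ hfin (Set.disjoint_left.2 (by
      rintro _ ⟨w, hw, rfl⟩
      exact hT w hw))
    have : Nonempty V := ⟨x⟩
    obtain ⟨f, hf, hinj⟩ := hfin.exists_injOn_of_encard_le (β := V)
      (t := G.nbhd ((wordAct g · x) '' (T : Set (List ℕ))) \ (R ∪ {x, y})) (by
        rw [← hfin.cast_ncard_eq, ← (finite_nbhd hLF hfin).sdiff.cast_ncard_eq]
        exact_mod_cast hle)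
    have hf' : ∀ w : T, ∃ v, wordAct g v x = f (wordAct g w x) := by
      intro w
      obtain ⟨_, ⟨w', -, rfl⟩, hadj⟩ := mem_nbhd.1 (hf ⟨w, w.2, rfl⟩).1
      exact h.exists_wordAct ((h.reachable w' x).trans hadj.reachable)
    choose φ hφ using hf'
    refine ⟨φ, fun w => ?_, fun w v hwv => ?_⟩
    · have hw := hf ⟨w, w.2, rfl⟩
      obtain ⟨_, ⟨w', hw', rfl⟩, hadj⟩ := mem_nbhd.1 hw.1
      rw [hφ]
      exact ⟨⟨⟨w', hw'⟩, hadj⟩, hw.2⟩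
    · rw [hφ, hφ] at hwv
      exact hinj ⟨w, w.2, rfl⟩ ⟨v, v.2, rfl⟩ hwv
  · intro hT
    refine HallOff.of_linked hLF fun F hF hl hd => ?_
    by_cases hN : ∃ z ∈ F, G.Reachable x z
    · obtain ⟨z, hz, hxz⟩ := hN
      have hreach : ∀ u ∈ F, ∃ w, wordAct g w x = u := by
        intro u hu
        obtain ⟨q⟩ := hl z hz u hu
        obtain ⟨q', -⟩ := Walk.exists_of_linkGraph q
        exact h.exists_wordAct (hxz.trans q'.reachable)
      classical
      choose! ω hω using hreach
      obtain ⟨φ, hφ, hφ'⟩ := hT (hF.toFinset.image ω) (fun w hw => by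
        obtain ⟨u, hu, rfl⟩ := Finset.mem_image.1 hw
        rw [hω u (hF.mem_toFinset.1 hu)]
        exact Set.disjoint_left.1 hd (hF.mem_toFinset.1 hu))
      have hmem : ∀ u ∈ F, ω u ∈ hF.toFinset.image ω := fun u hu =>
        Finset.mem_image_of_mem _ (hF.mem_toFinset.2 hu)
      let f : V → V := fun u => if hu : u ∈ F then wordAct g (φ ⟨ω u, hmem u hu⟩) x else u
      refine ncard_le_ncard_of_injOn f (fun u hu => ?_) (fun u hu v hv huv => ?_)
        (finite_nbhd hLF hF).sdiff
      · simp only [f, hu, dif_pos]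
        obtain ⟨⟨⟨w', hw'⟩, hadj⟩, hnot⟩ := hφ ⟨ω u, hmem u hu⟩
        obtain ⟨v, hv, rfl⟩ := Finset.mem_image.1 hw'
        rw [hF.mem_toFinset] at hv
        simp only [hω v hv] at hadj
        exact ⟨mem_nbhd.2 ⟨v, hv, hadj⟩, hnot⟩
      · simp only [f, hu, hv, dif_pos] at huv
        have := hφ' _ _ huv
        simpa only [hω u hu, hω v hv] using this
    · push Not at hN
      refine (hR F hF (hd.mono_right subset_union_left)).trans
        (ncard_le_ncard ?_ (finite_nbhd hLF hF).sdiff)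
      rintro v ⟨hv, hvR⟩
      obtain ⟨u, hu, huv⟩ := mem_nbhd.1 hv
      refine ⟨hv, ?_⟩
      rintro (h1 | rfl | rfl)
      · exact hvR h1
      · exact hN u hu huv.symm.reachable
      · exact hN u hu (hxy.trans huv.symm.reachable)

theorem IsMoves.measurableSet_hallOff {V : Type*} [MeasurableSpace V] [MeasurableEq V]
    {G : SimpleGraph V} {g : ℕ → V → V} (h : G.IsMoves g) (hg : ∀ k, Measurable (g k))
    (hG : MeasurableSet {p : V × V | G.Adj p.1 p.2})
    (hLF : ∀ v, (G.neighborSet v).Finite) {R : Set V} (hR : G.HallOff R) (hRm : MeasurableSet R)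
    (k : ℕ) : MeasurableSet {x | G.HallOff (R ∪ {x, g k x})} := by
  have hact := measurable_wordAct hg
  have hnot : ∀ w, MeasurableSet {x | wordAct g w x ∉ R ∪ {x, g k x}} := fun w =>
    (((hact w) hRm).union ((measurableSet_eq_fun (hact w) measurable_id).union
      (measurableSet_eq_fun (hact w) (hg k)))).compl
  have hadj : ∀ w v, MeasurableSet {x | G.Adj (wordAct g w x) (wordAct g v x)} := fun w v =>
    ((hact w).prodMk (hact v)) hG
  have heq : ∀ w v, MeasurableSet {x | wordAct g w x = wordAct g v x} := fun w v =>
    measurableSet_eq_fun (hact w) (hact v)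
  have hk : ∀ x, G.Reachable x (g k x) := fun x => h.reachable [k] x
  simp only [h.hallOff_iff hLF hR (hk _)]
  simp only [measurableSet_setOfPred] at hnot hadj heq ⊢
  refine Measurable.forall fun T => Measurable.imp (Measurable.forall fun w =>
    Measurable.imp measurable_const (hnot w)) (Measurable.exists fun φ => ?_)
  exact (Measurable.forall fun w => (Measurable.exists fun w' => hadj _ _).and (hnot _)).and
    (Measurable.forall fun w => Measurable.forall fun v => (heq _ _).imp (heq _ _))

theorem IsStage.injOn {G : SimpleGraph V} {R E : Set V} {p : V → V} {L : ℕ}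
    (h : G.IsStage R E p L) : InjOn p E := by
  intro x hx y hy hxy
  refine h.eq_of_walk x hx y hy
    (.cons (h.adj x hx) (.cons (hxy ▸ (h.adj y hy).symm : G.Adj (p x) y) .nil)) ?_
  simp

theorem IsStage.partner_notMem_self {G : SimpleGraph V} {R E : Set V} {p : V → V} {L : ℕ}
    (h : G.IsStage R E p L) {x : V} (hx : x ∈ E) : p x ∉ E := by
  intro hpx
  have hadj := h.adj x hx
  exact hadj.ne (h.eq_of_walk x hx _ hpx (.cons hadj .nil) (by simp))

theorem isStage_empty (G : SimpleGraph V) (R : Set V) (p : V → V) (L : ℕ) :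
    G.IsStage R ∅ p L :=
  ⟨by simp, by simp, by simp, by simp, by simp⟩

section Borel

open TopologicalSpace

variable [TopologicalSpace V] [PolishSpace V] [MeasurableSpace V] [BorelSpace V]

theorem IsMoves.exists_isStage_cover {G : SimpleGraph V} {g : ℕ → V → V} (h : G.IsMoves g)
    (hg : ∀ k, Measurable (g k)) (hG : MeasurableSet {p : V × V | G.Adj p.1 p.2})
    (hLF : ∀ v, (G.neighborSet v).Finite) {B₀ B₁ : Set V} (hbip : G.IsBipartiteWith B₀ B₁)
    {R : Set V} (hR : G.HallOff R) (hRm : MeasurableSet R) (L : ℕ) :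
    ∃ E : countableBasis V × ℕ → Set V, (∀ c, MeasurableSet (E c)) ∧
      (∀ c, G.IsStage R (E c) (g c.2) L) ∧ ∀ x ∉ R, ∃ c, x ∈ E c := by
  have hact := measurable_wordAct hg
  refine ⟨fun c => {x | x ∈ c.1.1 ∧ (∀ w : List ℕ, w.length ≤ 4 * L + 2 →
    wordAct g w x ∈ c.1.1 → wordAct g w x = x) ∧ x ∉ R ∧ G.Adj x (g c.2 x) ∧ g c.2 x ∉ R ∧
    G.HallOff (R ∪ {x, g c.2 x})}, fun c => ?_, fun c => ?_, fun x hx => ?_⟩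
  · have hU : MeasurableSet c.1.1 := (isOpen_of_mem_countableBasis c.1.2).measurableSet
    refine hU.inter (MeasurableSet.inter ?_ (hRm.compl.inter (MeasurableSet.inter ?_
      (((hg c.2) hRm).compl.inter (h.measurableSet_hallOff hg hG hLF hR hRm c.2)))))
    · have h1 : ∀ w, MeasurableSet {x | wordAct g w x ∈ c.1.1} := fun w => (hact w) hU
      have h2 : ∀ w, MeasurableSet {x | wordAct g w x = x} := fun w =>
        measurableSet_eq_fun (hact w) measurable_id
      simp only [measurableSet_setOfPred] at h1 h2
      exact measurableSet_setOfPred.2 (Measurable.forall fun w =>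
        Measurable.imp measurable_const ((h1 w).imp (h2 w)))
    · exact (measurable_id.prodMk (hg c.2)) hG
  · refine ⟨fun x hx y hy q hq => ?_, fun x hx => hx.2.2.2.1, fun x hx => hx.2.2.1,
      fun x hx => hx.2.2.2.2.1, fun x hx => hx.2.2.2.2.2⟩
    obtain ⟨w, hw, rfl⟩ := h.exists_wordAct_of_walk q
    exact (hx.2.1 w (hw.trans_le hq) hy.1).symm
  · obtain ⟨y, hxy, hy, hH⟩ := hR.exists_partner hLF hbip hx
    obtain ⟨k, rfl⟩ := h.exists_eq x y hxy
    obtain ⟨U, hU, hxU, hsub⟩ := (isBasis_countableBasis V).exists_subset_of_mem_open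
      (a := x) (u := ({y | ∃ w : List ℕ, w.length ≤ 4 * L + 2 ∧ wordAct g w x = y} \ {x})ᶜ)
      (by simp) (h.finite_wordAct hLF (4 * L + 2) x).sdiff.isClosed.isOpen_compl
    refine ⟨(⟨U, hU⟩, k), hxU, fun w hw hwU => ?_, hx, hxy, hy, hH⟩
    by_contra hne
    exact hsub hwU ⟨⟨w, hw, rfl⟩, hne⟩

theorem IsMoves.exists_isStage_not_isMeagre {G : SimpleGraph V} {g : ℕ → V → V}
    (h : G.IsMoves g) (hg : ∀ k, Measurable (g k))
    (hG : MeasurableSet {p : V × V | G.Adj p.1 p.2})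
    (hLF : ∀ v, (G.neighborSet v).Finite) {B₀ B₁ : Set V} (hbip : G.IsBipartiteWith B₀ B₁)
    {R : Set V} (hR : G.HallOff R) (hRm : MeasurableSet R) (L : ℕ) (f : V → V) {W : Set V}
    (hW : W ∈ countableBasis V) :
    ∃ (E : Set V) (k : ℕ), MeasurableSet E ∧ G.IsStage R E (g k) L ∧
      ¬ IsMeagre (W ∩ f ⁻¹' (R ∪ E)) := by
  by_contra! H
  obtain ⟨E, hEm, hE, hcov⟩ := h.exists_isStage_cover hg hG hLF hbip hR hRm L
  have : Countable (countableBasis V) := (countable_countableBasis V).to_subtype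
  refine not_isMeagre_of_isOpen (isOpen_of_mem_countableBasis hW)
    (nonempty_of_mem_countableBasis hW) (((H ∅ 0 .empty (isStage_empty G R _ L)).union
      (isMeagre_iUnion fun c => H (E c) c.2 (hEm c) (hE c))).mono ?_)
  intro x hx
  by_cases hfx : f x ∈ R
  · exact Or.inl ⟨hx, Or.inl hfx⟩
  · obtain ⟨c, hc⟩ := hcov _ hfx
    exact Or.inr (mem_iUnion.2 ⟨c, hx, Or.inr hc⟩)

theorem mem_residual_of_forall_not_isMeagre {A : Set V} (hA : MeasurableSet A)
    (h : ∀ W ∈ countableBasis V, ¬ IsMeagre (W ∩ A)) : A ∈ residual V := by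
  obtain ⟨U, hU, hAU⟩ := hA.compl.residualEq_isOpen
  have hUe : U = ∅ := by
    by_contra hne
    obtain ⟨x, hx⟩ := nonempty_iff_ne_empty.2 hne
    obtain ⟨W, hW, -, hWU⟩ := (isBasis_countableBasis V).exists_subset_of_mem_open hx hU
    refine h W hW ?_
    filter_upwards [hAU.mem_iff] with y hy
    rintro ⟨hyW, hyA⟩
    exact hy.2 (hWU hyW) hyA
  subst hUe
  filter_upwards [hAU.mem_iff] with y hy
  by_contra hyA
  exact hy.1 hyA

theorem exists_seq_isStage {G : SimpleGraph V} {g : ℕ → V → V} (h : G.IsMoves g)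
    (hg : ∀ k, Measurable (g k)) (hG : MeasurableSet {p : V × V | G.Adj p.1 p.2})
    (hLF : ∀ v, (G.neighborSet v).Finite) {B₀ B₁ : Set V} (hbip : G.IsBipartiteWith B₀ B₁)
    {ε : ℝ} (hε : 0 < ε) (hexp : ∀ F : Set V, F.Finite → G.Linked F →
      (1 + ε) * F.ncard ≤ ((G.nbhd F).ncard : ℝ))
    (f : ℕ → V → V) (W : ℕ → countableBasis V) :
    ∃ (R E : ℕ → Set V) (k L : ℕ → ℕ), R 0 = ∅ ∧ ∀ n, MeasurableSet (R n) ∧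
      MeasurableSet (E n) ∧ G.IsStage (R n) (E n) (g (k n)) (L n) ∧
      R (n + 1) = R n ∪ (E n ∪ g (k n) '' E n) ∧
      ¬ IsMeagre ((W n : Set V) ∩ f n ⁻¹' (R (n + 1))) := by
  obtain ⟨K, hK⟩ := exists_nat_gt (1 / ε)
  have hK0 : (0 : ℝ) < K := (one_div_pos.2 hε).trans hK
  let L : ℕ → ℕ := fun n => K * 2 ^ (n + 1)
  let δ : ℕ → ℝ := fun n => ε * (1 - (1 / 2) ^ n)
  have hLpos : ∀ n, 0 < L n := fun n => Nat.mul_pos (by exact_mod_cast hK0) (by positivity)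
  have hLmono : ∀ n, L n ≤ L (n + 1) := fun n =>
    Nat.mul_le_mul_left _ (Nat.pow_le_pow_right two_pos (Nat.le_succ _))
  have hδ : ∀ n, δ n + 2 / L (n + 1) ≤ δ (n + 1) := by
    intro n
    have h1 : (2 : ℝ) / L (n + 1) ≤ ε * (1 / 2) ^ (n + 1) := by
      rw [div_le_iff₀ (by exact_mod_cast hLpos _)]
      have h2 : 1 ≤ ε * K := by
        rw [div_lt_iff₀ hε] at hK
        linarith
      have h3 : ((1 : ℝ) / 2) ^ (n + 1) * 2 ^ (n + 1) = 1 := by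
        rw [← mul_pow]
        norm_num
      calc (2 : ℝ) ≤ 2 * (ε * K) := by linarith
        _ = 2 * (ε * K) * ((1 / 2) ^ (n + 1) * 2 ^ (n + 1)) := by rw [h3, mul_one]
        _ = ε * (1 / 2) ^ (n + 1) * (L (n + 1) : ℕ) := by
          simp only [L]
          push_cast
          ring
    have h4 : δ (n + 1) = δ n + ε * (1 / 2) ^ (n + 1) := by
      simp only [δ]
      ring
    rw [h4]
    linarith
  have hδε : ∀ n, δ n ≤ ε := fun n => by
    have : 0 ≤ ε * (1 / 2) ^ n := by positivity
    simp only [δ]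
    linarith
  let P : ℕ → Set V → Prop := fun n R =>
    MeasurableSet R ∧ G.HallOff R ∧ G.IsRare R (L n) (δ n)
  have hP0 : P 0 ∅ := by
    refine ⟨.empty, HallOff.of_linked hLF fun F hF hl _ => ?_, fun F hF hl _ => by simp [δ]⟩
    have := hexp F hF hl
    rw [sdiff_empty]
    have h2 : 0 ≤ ε * F.ncard := by positivity
    have : (F.ncard : ℝ) ≤ (G.nbhd F).ncard := by linarith
    exact_mod_cast this
  have hstep : ∀ n R, P n R → ∃ (E : Set V) (k : ℕ), MeasurableSet E ∧
      G.IsStage R E (g k) (L (n + 1)) ∧ P (n + 1) (R ∪ (E ∪ g k '' E)) ∧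
      ¬ IsMeagre ((W n : Set V) ∩ f n ⁻¹' (R ∪ (E ∪ g k '' E))) := by
    rintro n R ⟨hRm, hR, hrare⟩
    obtain ⟨E, k, hEm, hE, hW⟩ := h.exists_isStage_not_isMeagre hg hG hLF hbip hR hRm (L (n + 1))
      (f n) (W n).2
    refine ⟨E, k, hEm, hE, ⟨hRm.union (hEm.union (hEm.image_of_measurable_injOn (hg k) hE.injOn)),
      hE.hallOff_union hLF hexp hR hrare (hLmono n) (hLpos _) ((hδ n).trans (hδε _)), ?_⟩, ?_⟩
    · intro F hF hl hFL
      exact (hE.isRare_union hLF hrare (hLmono n) (hLpos _) F hF hl hFL).trans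
        (mul_le_mul_of_nonneg_right (hδ n) (Nat.cast_nonneg _))
    · refine fun hm => hW (hm.mono ?_)
      gcongr
      exact subset_union_left
  choose! E k hEm hE hP hW using hstep
  let R : ℕ → Set V := fun n => n.rec ∅ fun n R => R ∪ (E n R ∪ g (k n R) '' E n R)
  have hPR : ∀ n, P n (R n) := fun n => by
    induction n with
    | zero => exact hP0
    | succ n ih => exact hP n _ ih
  exact ⟨R, fun n => E n (R n), fun n => k n (R n), fun n => L (n + 1), rfl, fun n =>
    ⟨(hPR n).1, hEm n _ (hPR n), hE n _ (hPR n), rfl, hW n _ (hPR n)⟩⟩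

end Borel

end SimpleGraph

/-- **Marks–Unger.** A locally finite bipartite Borel graph whose finite
one-sided sets `F` all satisfy `|N(F)| ≥ (1+ε)|F|` admits a Borel perfect matching on a
Borel comeager invariant set. (The parts `B₀, B₁` need not be Borel.) -/
theorem stmt_8 {V : Type*} [TopologicalSpace V] [PolishSpace V]
    [MeasurableSpace V] [BorelSpace V]
    (G : SimpleGraph V) (hGmeas : MeasurableSet {p : V × V | G.Adj p.1 p.2})
    (hLF : ∀ v : V, (G.neighborSet v).Finite)
    (B₀ B₁ : Set V)
    (hunion : B₀ ∪ B₁ = univ) (hdisj : Disjoint B₀ B₁)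
    (hbip : ∀ x y : V, G.Adj x y → (x ∈ B₀ ↔ y ∈ B₁))
    (ε : ℝ) (hε : 0 < ε)
    (hexp : ∀ F : Set V, F.Finite → (F ⊆ B₀ ∨ F ⊆ B₁) →
      (1 + ε) * F.ncard ≤ ((⋃ x ∈ F, G.neighborSet x).ncard : ℝ)) :
    ∃ S : Set V, MeasurableSet S ∧ S ∈ residual V ∧ Invariant G S ∧
      ∃ M : Set (V × V), MeasurableSet M ∧ IsPerfectMatchingOn G S M := by
  rcases isEmpty_or_nonempty V with hV | ⟨⟨x₀⟩⟩
  · exact ⟨univ, .univ, Filter.univ_mem, fun _ _ _ _ => mem_univ _, ∅, .empty, by simp, by simp,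
      by simp, fun x => isEmptyElim x⟩
  obtain ⟨g, hg, hg₁, hg₂⟩ := exists_measurable_moves hGmeas hLF
  have hmv : G.IsMoves g := ⟨hg₁, hg₂⟩
  have hact := SimpleGraph.measurable_wordAct hg
  have hB : G.IsBipartiteWith B₀ B₁ := ⟨hdisj, fun x y hxy => by
    rcases hunion.ge (mem_univ x) with hx | hx
    · exact Or.inl ⟨hx, (hbip x y hxy).1 hx⟩
    · exact Or.inr ⟨hx, (hbip y x hxy.symm).2 hx⟩⟩
  have hexp' : ∀ F : Set V, F.Finite → G.Linked F → (1 + ε) * F.ncard ≤ ((G.nbhd F).ncard : ℝ) :=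
    fun F hF hl => hexp F hF (hl.subset_or_subset hunion hbip)
  have : Countable (TopologicalSpace.countableBasis V) :=
    (TopologicalSpace.countable_countableBasis V).to_subtype
  have : Nonempty (TopologicalSpace.countableBasis V) := by
    obtain ⟨W, hW, -⟩ := (TopologicalSpace.isBasis_countableBasis V).exists_subset_of_mem_open
      (mem_univ x₀) isOpen_univ
    exact ⟨⟨W, hW⟩⟩
  obtain ⟨goal, hgoal⟩ :=
    exists_surjective_nat (List ℕ × TopologicalSpace.countableBasis V)
  obtain ⟨R, E, k, L, hR0, hRE⟩ := SimpleGraph.exists_seq_isStage hmv hg hGmeas hLF hB hε hexp'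
    (fun n => SimpleGraph.wordAct g (goal n).1) (fun n => (goal n).2)
  choose hRm hEm hE hRs hW using hRE
  let S : Set V := {x | ∀ w : List ℕ, SimpleGraph.wordAct g w x ∈ ⋃ n, R n}
  have hSw : ∀ w, MeasurableSet {x | SimpleGraph.wordAct g w x ∈ ⋃ n, R n} := fun w =>
    (hact w) (MeasurableSet.iUnion hRm)
  have hS : S = ⋂ w, {x | SimpleGraph.wordAct g w x ∈ ⋃ n, R n} := by
    ext x
    simp [S]
  have hSm : MeasurableSet S := by
    rw [hS]
    exact .iInter hSw
  have hSinv : Invariant G S := by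
    intro x hx y hxy w
    obtain ⟨v, rfl⟩ := hmv.exists_wordAct hxy
    rw [← SimpleGraph.wordAct_append]
    exact hx _
  have hmono : Monotone R := monotone_nat_of_le_succ fun n => by
    rw [hRs]
    exact subset_union_left
  have hexists : ∀ n, ∀ x ∈ R n, ∃ m, x ∈ E m ∪ g (k m) '' E m := by
    intro n
    induction n with
    | zero => simp [hR0]
    | succ n ih =>
      intro x hx
      rw [hRs] at hx
      exact hx.elim (ih x) fun hx => ⟨n, hx⟩
  have hnot : ∀ n, ∀ x ∈ E n ∪ g (k n) '' E n, x ∉ R n := by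
    rintro n x (hx | ⟨y, hy, rfl⟩)
    · exact (hE n).notMem x hx
    · exact (hE n).partner_notMem y hy
  have huniq : ∀ m n x, x ∈ E m ∪ g (k m) '' E m → x ∈ E n ∪ g (k n) '' E n → m = n := by
    have hlt : ∀ m n x, m < n → x ∈ E m ∪ g (k m) '' E m → x ∉ E n ∪ g (k n) '' E n := by
      intro m n x hmn hm hn
      refine hnot n x hn (hmono (Nat.succ_le_of_lt hmn) ?_)
      rw [Nat.succ_eq_add_one, hRs]
      exact Or.inr hm
    intro m n x hm hn
    rcases lt_trichotomy m n with h | h | h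
    · exact absurd hn (hlt m n x h hm)
    · exact h
    · exact absurd hm (hlt n m x h hn)
  have hpair : ∀ n, MeasurableSet {q : V × V | q.1 ∈ E n ∧ q.2 = g (k n) q.1} := fun n =>
    (measurable_fst (hEm n)).inter
      (measurableSet_eq_fun measurable_snd ((hg (k n)).comp measurable_fst))
  let M : Set (V × V) := {q | q.1 ∈ S ∧ q.2 ∈ S ∧
    ∃ n, (q.1 ∈ E n ∧ q.2 = g (k n) q.1) ∨ (q.2 ∈ E n ∧ q.1 = g (k n) q.2)}
  have hM : ∀ x y, (x, y) ∈ M ↔ x ∈ S ∧ y ∈ S ∧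
      ∃ n, (x ∈ E n ∧ y = g (k n) x) ∨ (y ∈ E n ∧ x = g (k n) y) := fun _ _ => Iff.rfl
  refine ⟨S, hSm, ?_, hSinv, M, ?_, ?_, ?_, fun q hq => ⟨hq.1, hq.2.1⟩, ?_⟩
  · rw [hS, countable_iInter_mem]
    refine fun w => SimpleGraph.mem_residual_of_forall_not_isMeagre (hSw w) fun W hWb hm => ?_
    obtain ⟨n, hn⟩ := hgoal (w, ⟨W, hWb⟩)
    refine hW n (hm.mono ?_)
    rw [hn]
    exact inter_subset_inter_right _ fun x hx => mem_iUnion.2 ⟨n + 1, hx⟩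
  · refine (measurable_fst hSm).inter ((measurable_snd hSm).inter ?_)
    have : {q : V × V | ∃ n, (q.1 ∈ E n ∧ q.2 = g (k n) q.1) ∨ (q.2 ∈ E n ∧ q.1 = g (k n) q.2)} =
        ⋃ n, {q : V × V | q.1 ∈ E n ∧ q.2 = g (k n) q.1} ∪
          Prod.swap ⁻¹' {q : V × V | q.1 ∈ E n ∧ q.2 = g (k n) q.1} := by
      ext q
      simp
    change MeasurableSet {q : V × V | _}
    rw [this]
    exact .iUnion fun n => (hpair n).union (measurable_swap (hpair n))
  · rintro ⟨x, y⟩ hxy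
    obtain ⟨-, -, n, ⟨hx, rfl⟩ | ⟨hy, rfl⟩⟩ := (hM x y).1 hxy
    · exact (hE n).adj x hx
    · exact ((hE n).adj y hy).symm
  · rintro x y ⟨hx, hy, n, hn⟩
    exact ⟨hy, hx, n, hn.symm⟩
  · intro x hx
    obtain ⟨n, hn⟩ := mem_iUnion.1 (hx [])
    obtain ⟨m, hm⟩ := hexists n x hn
    refine existsUnique_of_exists_of_unique ?_ ?_
    · rcases hm with hm | ⟨y, hy, rfl⟩
      · exact ⟨g (k m) x, hx, hSinv hx ((hE m).adj x hm).reachable, m, Or.inl ⟨hm, rfl⟩⟩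
      · exact ⟨y, hx, hSinv hx ((hE m).adj y hy).symm.reachable, m, Or.inr ⟨hy, rfl⟩⟩
    · intro y z hy hz
      obtain ⟨-, -, i, hi⟩ := (hM x y).1 hy
      obtain ⟨-, -, j, hj⟩ := (hM x z).1 hz
      have hmem : ∀ i y, (x ∈ E i ∧ y = g (k i) x) ∨ (y ∈ E i ∧ x = g (k i) y) →
          x ∈ E i ∪ g (k i) '' E i := by
        rintro i y (⟨h, -⟩ | ⟨h, rfl⟩)
        · exact Or.inl h
        · exact Or.inr ⟨y, h, rfl⟩
      obtain rfl := huniq i j x (hmem i y hi) (hmem j z hj)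
      rcases hi with ⟨hi, rfl⟩ | ⟨hi, rfl⟩ <;> rcases hj with ⟨hj, hj'⟩ | ⟨hj, hj'⟩
      · exact hj'.symm
      · exact absurd hi (hj' ▸ (hE i).partner_notMem_self hj)
      · exact absurd hj ((hE i).partner_notMem_self hi)
      · exact (hE i).injOn hi hj hj'
end

section
/- Every locally finite graph in which every vertex has even degree admits a balanced orientation, i.e., an orientation of its edges in which every vertex has in-degree equal to out-degree. -/
open Set

/-- A finite set of even cardinality is preserved by an involution without fixed points in it. -/
lemma exists_involutive_of_even_ncard {α : Type*} {s : Set α} (hs : s.Finite)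
    (heven : Even s.ncard) :
    ∃ τ : α → α, Function.Involutive τ ∧ ∀ a ∈ s, τ a ∈ s ∧ τ a ≠ a := by
  classical
  obtain ⟨m, hm⟩ := heven
  have := hs.to_subtype
  have hcard : Nat.card s = m + m := hm
  let e : s ≃ Fin m ⊕ Fin m := (Finite.equivFinOfCardEq hcard).trans finSumFinEquiv.symm
  let σ : Equiv.Perm s := e.trans ((Equiv.sumComm _ _).trans e.symm)
  have hσ : σ * σ = 1 := by
    ext x
    simp [σ]
  refine ⟨Equiv.Perm.ofSubtype σ, fun a => ?_, fun a ha => ?_⟩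
  · rw [← Equiv.Perm.mul_apply, ← map_mul, hσ, map_one, Equiv.Perm.one_apply]
  · rw [Equiv.Perm.ofSubtype_apply_of_mem σ ha]
    refine ⟨Subtype.coe_prop _, fun h => ?_⟩
    have h' : e (σ ⟨a, ha⟩) = e ⟨a, ha⟩ := congrArg e (Subtype.ext h)
    simp only [σ, Equiv.trans_apply, Equiv.apply_symm_apply, Equiv.sumComm_apply] at h'
    cases hx : e ⟨a, ha⟩ <;> simp [hx] at h'

/-- If `r` inverts `f` by conjugation and, on an `f`-invariant set, neither `r` has a fixed point
nor `r` and `f` agree anywhere, then `r` moves every point of that set to another cycle of `f`. -/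
lemma not_sameCycle_of_conj_eq_inv {α : Type*} {f r : Equiv.Perm α} (hconj : r * f * r⁻¹ = f⁻¹)
    {p : α → Prop} (hp : ∀ a, p (f a) ↔ p a) (hr : ∀ a, p a → r a ≠ a)
    (hrf : ∀ a, p a → r a ≠ f a) {a : α} (ha : p a) : ¬ f.SameCycle a (r a) := by
  rintro ⟨n, hn⟩
  have hpow : ∀ k : ℤ, p ((f ^ k) a) := by
    intro k
    induction k using Int.induction_on with
    | zero => simpa
    | succ i ih => rwa [add_comm, zpow_add, zpow_one, Equiv.Perm.mul_apply, hp]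
    | pred i ih =>
      rw [← hp, ← Equiv.Perm.mul_apply, ← zpow_one_add]
      simpa using ih
  have hrev : ∀ k : ℤ, r ((f ^ k) a) = (f ^ (n - k)) a := by
    intro k
    have h : r * f ^ k = f ^ (-k) * r := by
      rw [zpow_neg, ← inv_zpow, ← hconj, conj_zpow]
      group
    rw [← Equiv.Perm.mul_apply, h, Equiv.Perm.mul_apply, ← hn, ← Equiv.Perm.mul_apply, ← zpow_add,
      neg_add_eq_sub]
  rcases Int.even_or_odd' n with ⟨k, hk | hk⟩
  · refine hr _ (hpow k) ?_
    rw [hrev, hk, two_mul, add_sub_cancel_right]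
  · refine hrf _ (hpow k) ?_
    rw [hrev, ← Equiv.Perm.mul_apply, ← zpow_one_add, hk]
    congr 2
    ring

/-- Every locally finite graph with only even degrees admits a balanced
orientation: a choice `O` of exactly one direction for each edge so that every vertex has
in-degree equal to out-degree. -/
theorem stmt_9 {V : Type*} (G : SimpleGraph V)
    (hLF : ∀ v : V, (G.neighborSet v).Finite)
    (heven : ∀ v : V, Even (G.neighborSet v).ncard) :
    ∃ O : Set (V × V),
      (∀ p ∈ O, G.Adj p.1 p.2) ∧
      (∀ x y : V, G.Adj x y → Xor' ((x, y) ∈ O) ((y, x) ∈ O)) ∧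
      (∀ v : V, {u : V | (u, v) ∈ O}.ncard = {u : V | (v, u) ∈ O}.ncard) := by
  choose τ hinv hτ using fun v => exists_involutive_of_even_ncard (hLF v) (heven v)
  have hadj : ∀ u v, G.Adj v (τ v u) ↔ G.Adj u v := fun u v =>
    ⟨fun h => by simpa [hinv v u] using ((hτ v _ h).1 : G.Adj v _).symm, fun h => (hτ v u h.symm).1⟩
  -- `f` sends a dart into `v` to the dart leaving `v` that is paired with it by `τ v`.
  let f : Equiv.Perm (V × V) :=
    { toFun := fun d => (d.2, τ d.2 d.1)
      invFun := fun d => (τ d.1 d.2, d.1)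
      left_inv := fun d => by simp [hinv d.2 d.1]
      right_inv := fun d => by simp [hinv d.1 d.2] }
  let r : Equiv.Perm (V × V) := Equiv.prodComm V V
  have hconj : r * f * r⁻¹ = f⁻¹ := rfl
  have hcycle : ∀ u v, G.Adj u v → ¬ f.SameCycle (u, v) (v, u) := fun u v h =>
    not_sameCycle_of_conj_eq_inv (r := r) (p := fun d => G.Adj d.1 d.2) hconj
      (fun d => hadj d.1 d.2) (fun d hd h => hd.ne (congrArg Prod.snd h))
      (fun d hd h => (hτ d.2 d.1 hd.symm).2 (congrArg Prod.snd h).symm) h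
  let q : V × V → Quotient (Equiv.Perm.SameCycle.setoid f) := Quotient.mk _
  have hq : ∀ d, q (f d) = q d := fun d =>
    Quotient.sound (Equiv.Perm.sameCycle_apply_left.2 (Equiv.Perm.SameCycle.refl f d))
  have hqr : ∀ d, q (r (f d)) = q (r d) := fun d => by
    have h : r d = f (r (f d)) := by
      simp [r, f, hinv d.2 d.1, Prod.swap]
    rw [h, hq]
  let O : Set (V × V) := {d | G.Adj d.1 d.2 ∧ WellOrderingRel (q d) (q (r d))}
  have hO : ∀ u v, (v, τ v u) ∈ O ↔ (u, v) ∈ O := fun u v =>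
    and_congr (hadj u v) (by
      change WellOrderingRel (q (f (u, v))) (q (r (f (u, v)))) ↔ _
      rw [hq, hqr])
  refine ⟨O, fun d hd => hd.1, fun x y h => ?_, fun v => ?_⟩
  · have hne : q (x, y) ≠ q (y, x) := fun e => hcycle x y h (Quotient.exact e)
    rcases trichotomous_of WellOrderingRel (q (x, y)) (q (y, x)) with hlt | heq | hgt
    · exact Or.inl ⟨⟨h, hlt⟩, fun h' => asymm_of WellOrderingRel hlt h'.2⟩
    · exact absurd heq hne
    · exact Or.inr ⟨⟨h.symm, hgt⟩, fun h' => asymm_of WellOrderingRel hgt h'.2⟩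
  · have himage : {u : V | (v, u) ∈ O} = τ v '' {u : V | (u, v) ∈ O} := by
      ext w
      constructor
      · intro hw
        refine ⟨τ v w, (hO _ v).1 ?_, hinv v w⟩
        rwa [hinv v w]
      · rintro ⟨u, hu, rfl⟩
        exact (hO u v).2 hu
    rw [himage, ncard_image_of_injective _ (hinv v).injective]
end

section
/- Let G be a locally finite graph with only even degrees, and let G* be its auxiliary bipartite graph. Then every perfect matching M* of G* induces a balanced orientation of G: orienting each edge e = {u,v} ∈ E(G) toward its endpoint v if and only if x_e is matched in M* to v_i for some i ∈ [deg(v)/2] yields a well-defined orientation of G in which every vertex has in-degree equal to out-degree. -/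
open Set

/-- `deg(v)/2`. -/
noncomputable def halfDeg {V : Type*} (G : SimpleGraph V) (v : V) : ℕ :=
  (G.neighborSet v).ncard / 2

/-- The vertices of the auxiliary graph `G*`: one vertex `x_e` for each edge `e` of `G`
(the left summand) and `deg(v)/2` vertices `v_i` for each vertex `v` of `G`
(the right summand). -/
def AuxVert {V : Type*} (G : SimpleGraph V) : Type _ :=
  G.edgeSet ⊕ (Σ v : V, Fin (halfDeg G v))

/-- The auxiliary bipartite graph `G*`: `x_e` is joined to `v_i` iff `v` is an endpoint
of `e`. -/
def auxGraph {V : Type*} (G : SimpleGraph V) : SimpleGraph (AuxVert G) :=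
  SimpleGraph.fromRel (fun a b =>
    match a, b with
    | Sum.inl e, Sum.inr p => p.1 ∈ (e : Sym2 V)
    | _, _ => False)

/-- The orientation of `G` induced by a matching `M` of `G*`: orient `e = {u,v}` toward
`v` iff `x_e` is matched to some copy `v_i` of `v`. -/
def inducedOrientation {V : Type*} (G : SimpleGraph V) (M : (auxGraph G).Subgraph) :
    Set (V × V) :=
  {p | ∃ h : G.Adj p.1 p.2, ∃ i : Fin (halfDeg G p.2),
    M.Adj (Sum.inl ⟨s(p.1, p.2), G.mem_edgeSet.mpr h⟩) (Sum.inr ⟨p.2, i⟩)}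

/-- Every neighbour of an edge-type vertex `x_e` of `G*` is a copy `v_i` of an endpoint of `e`. -/
lemma auxGraph_adj_inl {V : Type*} {G : SimpleGraph V} {e : G.edgeSet} {b : AuxVert G}
    (h : (auxGraph G).Adj (Sum.inl e) b) :
    ∃ p : Σ v : V, Fin (halfDeg G v), b = Sum.inr p ∧ p.1 ∈ (e : Sym2 V) := by
  obtain ⟨-, h⟩ := h
  rcases b with f | p
  · exact (h.elim id id : False).elim
  · exact ⟨p, rfl, h.resolve_right id⟩

/-- Every neighbour of a vertex-type vertex `v_i` of `G*` is `x_e` for an edge `e` at `v`. -/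
lemma auxGraph_adj_inr {V : Type*} {G : SimpleGraph V} {p : Σ v : V, Fin (halfDeg G v)}
    {b : AuxVert G} (h : (auxGraph G).Adj (Sum.inr p) b) :
    ∃ e : G.edgeSet, b = Sum.inl e ∧ p.1 ∈ (e : Sym2 V) := by
  obtain ⟨-, h⟩ := h
  rcases b with e | q
  · exact ⟨e, rfl, h.resolve_left id⟩
  · exact (h.elim id id : False).elim

/-- A perfect matching of `G*` orients every edge in exactly one direction. -/
lemma inducedOrientation_xor {V : Type*} {G : SimpleGraph V} {M : (auxGraph G).Subgraph}
    (hM : M.IsPerfectMatching) {x y : V} (hxy : G.Adj x y) :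
    Xor ((x, y) ∈ inducedOrientation G M) ((y, x) ∈ inducedOrientation G M) := by
  rw [SimpleGraph.Subgraph.isPerfectMatching_iff] at hM
  have swap : (⟨s(y, x), G.mem_edgeSet.mpr hxy.symm⟩ : G.edgeSet) =
      ⟨s(x, y), G.mem_edgeSet.mpr hxy⟩ := Subtype.ext Sym2.eq_swap
  have not_both : ¬ ((x, y) ∈ inducedOrientation G M ∧ (y, x) ∈ inducedOrientation G M) := by
    rintro ⟨⟨_, i, hi⟩, ⟨_, j, hj⟩⟩
    dsimp only at i hi j hj
    rw [swap] at hj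
    have h := Sum.inr.inj ((hM _).unique hi hj)
    exact hxy.ne (congrArg Sigma.fst h).symm
  have some_dir : (x, y) ∈ inducedOrientation G M ∨ (y, x) ∈ inducedOrientation G M := by
    obtain ⟨b, hb, -⟩ := hM (Sum.inl ⟨s(x, y), G.mem_edgeSet.mpr hxy⟩)
    obtain ⟨⟨w, i⟩, rfl, hw⟩ := auxGraph_adj_inl hb.adj_sub
    rcases Sym2.mem_iff.mp hw with h | h <;> dsimp only at h <;> subst h
    · exact Or.inr ⟨hxy.symm, i, by simpa only [swap] using hb⟩
    · exact Or.inl ⟨hxy, i, hb⟩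
  exact (xor_iff_or_and_not_and _ _).mpr ⟨some_dir, not_both⟩

/-- In the orientation induced by a perfect matching, `v` has in-degree `deg(v)/2`. -/
lemma ncard_inducedOrientation_in {V : Type*} {G : SimpleGraph V} {M : (auxGraph G).Subgraph}
    (hM : M.IsPerfectMatching) (v : V) :
    {u : V | (u, v) ∈ inducedOrientation G M}.ncard = halfDeg G v := by
  rw [SimpleGraph.Subgraph.isPerfectMatching_iff] at hM
  have partner : ∀ i : Fin (halfDeg G v), ∃ u : V, ∃ h : G.Adj u v,
      M.Adj (Sum.inl ⟨s(u, v), G.mem_edgeSet.mpr h⟩) (Sum.inr ⟨v, i⟩) := by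
    intro i
    obtain ⟨b, hb, -⟩ := hM (Sum.inr ⟨v, i⟩)
    obtain ⟨⟨e, he⟩, rfl, hv⟩ := auxGraph_adj_inr hb.adj_sub
    obtain ⟨u, rfl⟩ := Sym2.mem_iff_exists.mp hv
    have hvu : G.Adj v u := G.mem_edgeSet.mp he
    refine ⟨u, hvu.symm, ?_⟩
    have swap : (⟨s(u, v), G.mem_edgeSet.mpr hvu.symm⟩ : G.edgeSet) = ⟨s(v, u), he⟩ :=
      Subtype.ext Sym2.eq_swap
    rw [swap]
    exact hb.symm
  choose g hg hgM using partner
  have g_inj : Function.Injective g := by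
    intro i j hij
    have hj := hgM j
    simp only [← hij] at hj
    simpa using Sum.inr.inj ((hM _).unique (hgM i) hj)
  have range_g : {u : V | (u, v) ∈ inducedOrientation G M} = Set.range g := by
    ext u
    constructor
    · rintro ⟨_, i, hi⟩
      have h := Sum.inl.inj ((hM _).unique (hgM i).symm hi.symm)
      exact ⟨i, Sym2.congr_left.mp (congrArg Subtype.val h)⟩
    · rintro ⟨i, rfl⟩
      exact ⟨hg i, i, hgM i⟩
  rw [range_g, ← Set.image_univ, Set.ncard_image_of_injective _ g_inj, Set.ncard_univ,
    Nat.card_eq_fintype_card, Fintype.card_fin]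

/-- For a locally finite graph `G` with only even degrees, every
perfect matching of the auxiliary graph `G*` induces a balanced orientation of `G`. -/
theorem stmt_10 {V : Type*} (G : SimpleGraph V)
    (hLF : ∀ v : V, (G.neighborSet v).Finite)
    (heven : ∀ v : V, Even (G.neighborSet v).ncard)
    (M : (auxGraph G).Subgraph) (hM : M.IsPerfectMatching) :
    (∀ x y : V, G.Adj x y →
      Xor' ((x, y) ∈ inducedOrientation G M) ((y, x) ∈ inducedOrientation G M)) ∧
    (∀ v : V, {u : V | (u, v) ∈ inducedOrientation G M}.ncard
      = {u : V | (v, u) ∈ inducedOrientation G M}.ncard) := by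
  refine ⟨fun x y hxy => inducedOrientation_xor hM hxy, fun v => ?_⟩
  have out_eq : {u : V | (v, u) ∈ inducedOrientation G M} =
      G.neighborSet v \ {u : V | (u, v) ∈ inducedOrientation G M} := by
    ext u
    constructor
    · intro h
      have hvu : G.Adj v u := h.1
      exact ⟨hvu, fun h' =>
        ((xor_iff_or_and_not_and _ _).mp (inducedOrientation_xor hM hvu)).2 ⟨h, h'⟩⟩
    · rintro ⟨hvu, h'⟩
      exact (inducedOrientation_xor hM hvu).or.resolve_right h'
  have in_sub : {u : V | (u, v) ∈ inducedOrientation G M} ⊆ G.neighborSet v :=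
    fun u h => h.1.symm
  have hdiff := Set.ncard_sdiff_add_ncard_of_subset in_sub (hLF v)
  rw [← out_eq, ncard_inducedOrientation_in hM v] at hdiff
  rw [ncard_inducedOrientation_in hM v]
  obtain ⟨k, hk⟩ := heven v
  simp only [halfDeg] at hdiff ⊢
  omega
end

section
/- Let G be a graph with only even degrees, all degrees bounded by d, such that |E(F, V(G) \ F)| ≥ δ|F| for every finite F ⊆ V(G), where δ > 0. Let G* be the auxiliary bipartite graph of G. Then for every finite set F of vertex-type vertices of G* (i.e., F ⊆ {v_i : v ∈ V(G), i ∈ [deg(v)/2]}), the neighborhood in G* satisfies |N_{G*}(F)| ≥ (1 + δ/d)|F|. -/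
open Set

/-- The set of edges of `G` with at least one endpoint in `A`. -/
def edgesMeeting {V : Type*} (G : SimpleGraph V) (A : Set V) : Set (Sym2 V) :=
  {e | e ∈ G.edgeSet ∧ ∃ a ∈ A, a ∈ e}

theorem edgesMeeting_finite {V : Type*} (G : SimpleGraph V)
    (hLF : ∀ v : V, (G.neighborSet v).Finite) {A : Set V} (hA : A.Finite) :
    (edgesMeeting G A).Finite := by
  refine (hA.biUnion fun v _ => (hLF v).image fun w => s(v, w)).subset ?_
  rintro e ⟨he, a, ha, hae⟩
  obtain ⟨w, rfl⟩ := Sym2.mem_iff_exists.mp hae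
  exact mem_biUnion ha ⟨w, he, rfl⟩

theorem edgesBetween_compl_subset_edgesMeeting {V : Type*} (G : SimpleGraph V) (A : Set V) :
    edgesBetween G A Aᶜ ⊆ edgesMeeting G A := by
  rintro e ⟨he, a, ha, b, _, rfl⟩
  exact ⟨he, a, ha, Sym2.mem_mk_left a b⟩

open Classical in
theorem card_filter_mem_add_boundary_le_two {V : Type*} (G : SimpleGraph V) (S : Finset V)
    (e : Sym2 V) :
    (S.filter (· ∈ e)).card + (if e ∈ edgesBetween G S (S : Set V)ᶜ then 1 else 0) ≤ 2 := by
  split_ifs with h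
  · obtain ⟨_, a, _, b, hb, rfl⟩ := h
    have hsub : S.filter (· ∈ s(a, b)) ⊆ {a} := by
      intro x hx
      rw [Finset.mem_filter, Sym2.mem_iff] at hx
      obtain ⟨hxS, rfl | rfl⟩ := hx
      · exact Finset.mem_singleton_self x
      · exact absurd hxS hb
    have := Finset.card_le_card hsub
    rw [Finset.card_singleton] at this
    omega
  · induction e with
    | _ a b =>
      have hsub : S.filter (· ∈ s(a, b)) ⊆ {a, b} := by
        intro x hx
        simpa using (Finset.mem_filter.mp hx).2
      exact (Finset.card_le_card hsub).trans Finset.card_le_two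

theorem sum_degree_add_boundary_le {V : Type*} (G : SimpleGraph V)
    (hLF : ∀ v : V, (G.neighborSet v).Finite) (S : Finset V) :
    ∑ v ∈ S, (G.neighborSet v).ncard + (edgesBetween G S (S : Set V)ᶜ).ncard
      ≤ 2 * (edgesMeeting G S).ncard := by
  classical
  have hfin := edgesMeeting_finite G hLF S.finite_toSet
  set I := hfin.toFinset with hI
  have hdeg : ∀ v ∈ S, (G.neighborSet v).ncard ≤ (I.filter (v ∈ ·)).card := by
    intro v hv
    rw [← Set.ncard_coe_finset]
    refine Set.ncard_le_ncard_of_injOn (fun w => s(v, w)) ?_ ?_ (Finset.finite_toSet _)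
    · intro w hw
      rw [Finset.mem_coe, Finset.mem_filter, hI, Set.Finite.mem_toFinset]
      exact ⟨⟨hw, v, hv, Sym2.mem_mk_left v w⟩, Sym2.mem_mk_left v w⟩
    · intro w _ w' _ h
      exact Sym2.congr_right.mp h
  have hbd : (edgesBetween G S (S : Set V)ᶜ).ncard =
      ∑ e ∈ I, if e ∈ edgesBetween G S (S : Set V)ᶜ then 1 else 0 := by
    rw [← Finset.card_filter, ← Set.ncard_coe_finset]
    congr 1
    ext e
    simp only [Finset.coe_filter, hI, Set.Finite.mem_toFinset, Set.mem_ofPred_eq]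
    exact ⟨fun h => ⟨edgesBetween_compl_subset_edgesMeeting G _ h, h⟩, fun h => h.2⟩
  have hcount : ∑ v ∈ S, (I.filter (v ∈ ·)).card = ∑ e ∈ I, (S.filter (· ∈ e)).card :=
    Finset.sum_card_bipartiteAbove_eq_sum_card_bipartiteBelow (fun v e => v ∈ e)
  calc ∑ v ∈ S, (G.neighborSet v).ncard + (edgesBetween G S (S : Set V)ᶜ).ncard
      ≤ ∑ e ∈ I, (S.filter (· ∈ e)).card +
        ∑ e ∈ I, (if e ∈ edgesBetween G S (S : Set V)ᶜ then 1 else 0) := by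
        rw [hbd, ← hcount]
        gcongr with v hv
        exact hdeg v hv
    _ ≤ ∑ _e ∈ I, 2 := by
        rw [← Finset.sum_add_distrib]
        exact Finset.sum_le_sum fun e _ => card_filter_mem_add_boundary_le_two G S e
    _ = 2 * (edgesMeeting G S).ncard := by
        rw [Finset.sum_const, smul_eq_mul, mul_comm, Set.ncard_eq_toFinset_card _ hfin]

theorem auxGraph_adj_inr_inl {V : Type*} (G : SimpleGraph V)
    (p : Σ v : V, Fin (halfDeg G v)) (e : G.edgeSet) :
    (auxGraph G).Adj (Sum.inr p) (Sum.inl e) ↔ p.1 ∈ (e : Sym2 V) := by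
  refine ⟨fun h => ?_, fun h => ⟨Sum.inr_ne_inl, Or.inr h⟩⟩
  obtain ⟨_, h | h⟩ := h
  · exact h.elim
  · exact h

theorem not_auxGraph_adj_inr_inr {V : Type*} (G : SimpleGraph V)
    (p q : Σ v : V, Fin (halfDeg G v)) :
    ¬ (auxGraph G).Adj (Sum.inr p) (Sum.inr q) := by
  rintro ⟨_, h | h⟩
  · exact h
  · exact h

theorem iUnion_neighborSet_auxGraph_image_inr {V : Type*} (G : SimpleGraph V)
    (P : Set (Σ v : V, Fin (halfDeg G v))) :
    (⋃ a ∈ (Sum.inr '' P : Set (AuxVert G)), (auxGraph G).neighborSet a) =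
      Sum.inl '' ((↑) ⁻¹' edgesMeeting G (Sigma.fst '' P) : Set G.edgeSet) := by
  ext x
  simp only [Set.mem_iUnion, SimpleGraph.mem_neighborSet]
  constructor
  · rintro ⟨_, ⟨p, hp, rfl⟩, hx⟩
    rcases x with e | q
    · exact ⟨e, ⟨e.2, p.1, ⟨p, hp, rfl⟩, (auxGraph_adj_inr_inl G p e).mp hx⟩, rfl⟩
    · exact absurd hx (not_auxGraph_adj_inr_inr G p q)
  · rintro ⟨e, ⟨_, _, ⟨p, hp, rfl⟩, hpe⟩, rfl⟩
    exact ⟨Sum.inr p, ⟨p, hp, rfl⟩, (auxGraph_adj_inr_inl G p e).mpr hpe⟩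

theorem ncard_preimage_edgesMeeting {V : Type*} (G : SimpleGraph V) (A : Set V) :
    ((↑) ⁻¹' edgesMeeting G A : Set G.edgeSet).ncard = (edgesMeeting G A).ncard := by
  rw [← Set.ncard_image_of_injective _ Subtype.val_injective, Subtype.image_preimage_coe,
    Set.inter_eq_right.mpr fun _ he => he.1]

theorem ncard_le_sum_halfDeg {V : Type*} (G : SimpleGraph V)
    (P : Set (Σ v : V, Fin (halfDeg G v))) (S : Finset V) (hS : Sigma.fst '' P ⊆ S) :
    P.ncard ≤ ∑ v ∈ S, halfDeg G v := by
  have hsub : P ⊆ (S.sigma fun v => (Finset.univ : Finset (Fin (halfDeg G v))) : Finset _) := by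
    intro p hp
    rw [Finset.mem_coe, Finset.mem_sigma]
    exact ⟨hS ⟨p, hp, rfl⟩, Finset.mem_univ _⟩
  calc P.ncard ≤ _ := Set.ncard_le_ncard hsub (Finset.finite_toSet _)
    _ = ∑ v ∈ S, halfDeg G v := by
      rw [Set.ncard_coe_finset, Finset.card_sigma]
      simp only [Finset.card_univ, Fintype.card_fin]

/-- If `G` has only even degrees, all degrees at most `d`, and
expansion constant `δ`, then every finite set `F` of vertex-type vertices of `G*`
satisfies `|N_{G*}(F)| ≥ (1 + δ/d)|F|`. -/
theorem stmt_11 {V : Type*} (G : SimpleGraph V)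
    (d : ℕ) (δ : ℝ) (hδ : 0 < δ)
    (hLF : ∀ v : V, (G.neighborSet v).Finite)
    (heven : ∀ v : V, Even (G.neighborSet v).ncard)
    (hdeg : ∀ v : V, (G.neighborSet v).ncard ≤ d)
    (hexp : ∀ F : Set V, F.Finite →
      δ * F.ncard ≤ ((edgesBetween G F Fᶜ).ncard : ℝ))
    (F : Set (AuxVert G)) (hF : F.Finite)
    (htype : F ⊆ Set.range Sum.inr) :
    (⋃ a ∈ F, (auxGraph G).neighborSet a).Finite ∧
    (1 + δ / d) * F.ncard ≤ (((⋃ a ∈ F, (auxGraph G).neighborSet a).ncard : ℝ)) := by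
  obtain ⟨P, rfl⟩ : ∃ P : Set (Σ v : V, Fin (halfDeg G v)),
      (Sum.inr '' P : Set (AuxVert G)) = F := Set.subset_range_iff_exists_image_eq.mp htype
  have hP : P.Finite := hF.of_finite_image Sum.inr_injective.injOn
  obtain ⟨S, hS⟩ := (hP.image Sigma.fst).exists_finset_coe
  rw [iUnion_neighborSet_auxGraph_image_inr, ← hS]
  refine ⟨((edgesMeeting_finite G hLF S.finite_toSet).preimage
    Subtype.val_injective.injOn).image _, ?_⟩
  have hN : (Sum.inl '' ((↑) ⁻¹' edgesMeeting G S : Set G.edgeSet) : Set (AuxVert G)).ncard =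
      (edgesMeeting G S).ncard :=
    (Set.ncard_image_of_injective _ Sum.inl_injective).trans (ncard_preimage_edgesMeeting G S)
  have hFP : (Sum.inr '' P : Set (AuxVert G)).ncard = P.ncard :=
    Set.ncard_image_of_injective _ Sum.inr_injective
  refine (congrArg (fun n : ℕ => (1 + δ / d) * (n : ℝ)) hFP).trans_le
    (le_of_le_of_eq ?_ (congrArg Nat.cast hN.symm))
  have hPle := ncard_le_sum_halfDeg G P S hS.ge
  have hhalf : ∑ v ∈ S, (G.neighborSet v).ncard = 2 * ∑ v ∈ S, halfDeg G v := by
    rw [Finset.mul_sum]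
    exact Finset.sum_congr rfl fun v _ => (Nat.two_mul_div_two_of_even (heven v)).symm
  have hdS : ∑ v ∈ S, (G.neighborSet v).ncard ≤ S.card * d :=
    Finset.sum_le_card_nsmul S _ d fun v _ => hdeg v
  have hcount := sum_degree_add_boundary_le G hLF S
  have hbd := hexp S S.finite_toSet
  rw [Set.ncard_coe_finset] at hbd
  rw [hhalf] at hcount hdS
  have hPd : δ / d * (2 * P.ncard) ≤ δ * S.card := by
    rcases Nat.eq_zero_or_pos d with rfl | hd
    · simp only [Nat.cast_zero, div_zero, zero_mul]
      positivity
    · have hd' : (0 : ℝ) < d := by exact_mod_cast hd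
      have h : (2 * P.ncard : ℝ) ≤ S.card * d := by
        exact_mod_cast (Nat.mul_le_mul_left 2 hPle).trans hdS
      calc δ / d * (2 * P.ncard) ≤ δ / d * (S.card * d) := by gcongr
        _ = δ * S.card := by field_simp
  have hcount' : (2 * P.ncard : ℝ) + (edgesBetween G S (S : Set V)ᶜ).ncard ≤
      2 * (edgesMeeting G S).ncard := by
    exact_mod_cast (Nat.add_le_add_right (Nat.mul_le_mul_left 2 hPle) _).trans hcount
  linarith
end

section
/- Let G be a graph with only even degrees, all degrees bounded by d, such that |E(F, V(G) \ F)| ≥ δ|F| for every finite F ⊆ V(G), where δ > 0. Let G* be the auxiliary bipartite graph of G. Then for every finite set F of edge-type vertices of G* (i.e., F ⊆ {x_e : e ∈ E(G)}), the neighborhood in G* satisfies |N_{G*}(F)| ≥ (1 + δ/(2d))|F|. -/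
open Set

theorem ncard_incidenceSet {V : Type*} (G : SimpleGraph V) (v : V) :
    (G.incidenceSet v).ncard = (G.neighborSet v).ncard := by
  classical
  exact Nat.card_congr (G.incidenceSetEquivNeighborSet v)

theorem finite_incidenceSet {V : Type*} (G : SimpleGraph V) (v : V)
    (h : (G.neighborSet v).Finite) : (G.incidenceSet v).Finite := by
  classical
  have := h.to_subtype
  exact Finite.of_equiv _ (G.incidenceSetEquivNeighborSet v).symm

theorem finite_edgesBetween {V : Type*} (G : SimpleGraph V)
    (hLF : ∀ v : V, (G.neighborSet v).Finite) {A : Set V} (hA : A.Finite) (B : Set V) :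
    (edgesBetween G A B).Finite := by
  refine (hA.biUnion fun v _ => finite_incidenceSet G v (hLF v)).subset ?_
  rintro e ⟨he, a, ha, b, -, rfl⟩
  exact mem_biUnion ha ⟨he, Sym2.mem_mk_left a b⟩

/-- The degree sum over `U` counts every edge inside `U` twice and every boundary edge once. -/
theorem two_mul_card_add_ncard_edgesBetween_compl_le {V : Type*} (G : SimpleGraph V)
    (hLF : ∀ v : V, (G.neighborSet v).Finite) (E : Finset (Sym2 V)) (hE : ↑E ⊆ G.edgeSet)
    (U : Finset V) (hU : ∀ e ∈ E, ∀ v ∈ e, v ∈ U) :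
    2 * E.card + (edgesBetween G U (U : Set V)ᶜ).ncard ≤
      ∑ v ∈ U, (G.neighborSet v).ncard := by
  classical
  have hB := finite_edgesBetween G hLF U.finite_toSet (U : Set V)ᶜ
  set B := hB.toFinset with hBdef
  have hmemB : ∀ e, e ∈ B ↔ e ∈ edgesBetween G U (U : Set V)ᶜ := fun e => hB.mem_toFinset
  have hdisj : Disjoint E B := by
    rw [Finset.disjoint_left]
    intro e he heB
    obtain ⟨-, a, -, b, hb, rfl⟩ := (hmemB e).1 heB
    exact hb (hU _ he b (Sym2.mem_mk_right a b))
  have hinside : ∀ e ∈ E, 2 ≤ (U.filter fun v => v ∈ e).card := by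
    intro e he
    induction e with
    | _ a b =>
      have hab : a ≠ b := G.ne_of_adj (hE he)
      rw [← Finset.card_pair hab]
      refine Finset.card_le_card fun v hv => ?_
      have hv' : v ∈ s(a, b) := by simpa using hv
      exact Finset.mem_filter.2 ⟨hU _ he v hv', hv'⟩
  have hboundary : ∀ e ∈ B, 1 ≤ (U.filter fun v => v ∈ e).card := by
    intro e he
    obtain ⟨-, a, ha, b, -, rfl⟩ := (hmemB e).1 he
    exact Finset.card_pos.2 ⟨a, Finset.mem_filter.2 ⟨ha, Sym2.mem_mk_left a b⟩⟩
  calc 2 * E.card + (edgesBetween G U (U : Set V)ᶜ).ncard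
      = ∑ _e ∈ E, 2 + ∑ _e ∈ B, 1 := by
        rw [ncard_eq_toFinset_card _ hB]; simp [hBdef, mul_comm]
    _ ≤ ∑ e ∈ E, (U.filter fun v => v ∈ e).card + ∑ e ∈ B, (U.filter fun v => v ∈ e).card :=
        add_le_add (Finset.sum_le_sum hinside) (Finset.sum_le_sum hboundary)
    _ = ∑ e ∈ E ∪ B, (U.filter fun v => v ∈ e).card := (Finset.sum_union hdisj).symm
    _ = ∑ v ∈ U, ((E ∪ B).filter fun e => v ∈ e).card :=
        (Finset.sum_card_bipartiteAbove_eq_sum_card_bipartiteBelow (fun v e => v ∈ e)).symm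
    _ ≤ ∑ v ∈ U, (G.neighborSet v).ncard := by
        refine Finset.sum_le_sum fun v _ => ?_
        rw [← ncard_incidenceSet, ← ncard_coe_finset]
        refine ncard_le_ncard (fun e he => ?_) (finite_incidenceSet G v (hLF v))
        obtain ⟨he, hv⟩ := Finset.mem_filter.1 he
        refine ⟨?_, hv⟩
        rcases Finset.mem_union.1 he with he | he
        · exact hE he
        · exact ((hmemB e).1 he).1

/-- The vertex `x_e` of the auxiliary graph. -/
def AuxVert.ofEdge {V : Type*} {G : SimpleGraph V} : G.edgeSet ↪ AuxVert G :=
  ⟨Sum.inl, Sum.inl_injective⟩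

/-- The vertex `v_i` of the auxiliary graph. -/
def AuxVert.ofVertex {V : Type*} {G : SimpleGraph V} :
    (Σ v : V, Fin (halfDeg G v)) ↪ AuxVert G :=
  ⟨Sum.inr, Sum.inr_injective⟩

theorem auxGraph_adj_ofEdge_iff {V : Type*} (G : SimpleGraph V) (e : G.edgeSet)
    (b : AuxVert G) :
    (auxGraph G).Adj (AuxVert.ofEdge e) b ↔
      ∃ p : Σ v : V, Fin (halfDeg G v), AuxVert.ofVertex p = b ∧ p.1 ∈ (e : Sym2 V) := by
  rcases b with f | p
  · constructor
    · rintro ⟨-, h | h⟩ <;> exact h.elim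
    · rintro ⟨p, h, -⟩
      exact (Sum.inr_ne_inl h).elim
  · constructor
    · rintro ⟨-, h | h⟩
      · exact ⟨p, rfl, h⟩
      · exact h.elim
    · rintro ⟨q, h, hq⟩
      obtain rfl : q = p := Sum.inr_injective h
      exact ⟨Sum.inl_ne_inr, Or.inl hq⟩

/-- If `G` has only even degrees, all degrees at most `d`, and
expansion constant `δ`, then every finite set `F` of edge-type vertices of `G*`
satisfies `|N_{G*}(F)| ≥ (1 + δ/(2d))|F|`. -/
theorem stmt_12 {V : Type*} (G : SimpleGraph V)
    (d : ℕ) (δ : ℝ) (hδ : 0 < δ)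
    (hLF : ∀ v : V, (G.neighborSet v).Finite)
    (heven : ∀ v : V, Even (G.neighborSet v).ncard)
    (hdeg : ∀ v : V, (G.neighborSet v).ncard ≤ d)
    (hexp : ∀ F : Set V, F.Finite →
      δ * F.ncard ≤ ((edgesBetween G F Fᶜ).ncard : ℝ))
    (F : Set (AuxVert G)) (hF : F.Finite)
    (htype : F ⊆ Set.range Sum.inl) :
    (⋃ a ∈ F, (auxGraph G).neighborSet a).Finite ∧
    (1 + δ / (2 * d)) * F.ncard ≤ (((⋃ a ∈ F, (auxGraph G).neighborSet a).ncard : ℝ)) := by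
  classical
  change F ⊆ range AuxVert.ofEdge at htype
  obtain ⟨E, rfl⟩ : ∃ E : Finset G.edgeSet,
      F = AuxVert.ofEdge '' (E : Set G.edgeSet) := by
    obtain ⟨E, rfl⟩ := subset_range_iff_exists_image_eq.1 htype
    have hfin : E.Finite := hF.of_finite_image AuxVert.ofEdge.injective.injOn
    exact ⟨hfin.toFinset, by simp⟩
  set U : Finset V := E.biUnion fun e => (e : Sym2 V).toFinset with hUdef
  have hmemU : ∀ v, v ∈ U ↔ ∃ e ∈ E, v ∈ (e : Sym2 V) := by simp [hUdef]
  have hN : (⋃ a ∈ AuxVert.ofEdge '' (E : Set G.edgeSet),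
      (auxGraph G).neighborSet a) =
      ((U.sigma fun v => (Finset.univ : Finset (Fin (halfDeg G v)))).map
        AuxVert.ofVertex : Finset (AuxVert G)) := by
    ext b
    rw [biUnion_image]
    simp only [mem_iUnion, SimpleGraph.mem_neighborSet, auxGraph_adj_ofEdge_iff, Finset.coe_map,
      mem_image, Finset.mem_coe, Finset.mem_sigma, Finset.mem_univ, and_true, hmemU]
    constructor
    · rintro ⟨e, he, p, rfl, hp⟩
      exact ⟨p, ⟨e, he, hp⟩, rfl⟩
    · rintro ⟨p, ⟨e, he, hp⟩, rfl⟩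
      exact ⟨e, he, p, rfl, hp⟩
  rw [hN]
  refine ⟨Finset.finite_toSet _, ?_⟩
  rw [ncard_coe_finset, ncard_image_of_injective _ AuxVert.ofEdge.injective, ncard_coe_finset,
    Finset.card_map, Finset.card_sigma]
  simp only [Finset.card_univ, Fintype.card_fin]
  have hhalf : 2 * ∑ v ∈ U, halfDeg G v = ∑ v ∈ U, (G.neighborSet v).ncard := by
    rw [Finset.mul_sum]
    exact Finset.sum_congr rfl fun v _ => Nat.two_mul_div_two_of_even (heven v)
  have hcount := two_mul_card_add_ncard_edgesBetween_compl_le G hLF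
    (E.map (Function.Embedding.subtype _)) (by simp) U (by
      intro e he v hv
      obtain ⟨f, hf, rfl⟩ := Finset.mem_map.1 he
      exact (hmemU v).2 ⟨f, hf, hv⟩)
  rw [Finset.card_map, ← hhalf] at hcount
  have hbound : 2 * ∑ v ∈ U, halfDeg G v ≤ U.card * d := by
    rw [hhalf]
    exact Finset.sum_le_card_nsmul _ _ _ fun v _ => hdeg v
  have hexpU := hexp U U.finite_toSet
  rw [ncard_coe_finset] at hexpU
  generalize ∑ v ∈ U, halfDeg G v = n at *
  have hEU : E.card ≤ U.card * d := by omega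
  have hcount' : 2 * (E.card : ℝ) + (edgesBetween G U (U : Set V)ᶜ).ncard ≤ 2 * n := by
    exact_mod_cast hcount
  have hEU' : (E.card : ℝ) ≤ U.card * d := by exact_mod_cast hEU
  have hdiv : (E.card : ℝ) / d ≤ U.card := div_le_of_le_mul₀ (by positivity) (by positivity) hEU'
  have hgain : δ * ((E.card : ℝ) / d) ≤ δ * U.card := mul_le_mul_of_nonneg_left hdiv hδ.le
  calc (1 + δ / (2 * d)) * (E.card : ℝ) = E.card + δ * ((E.card : ℝ) / d) / 2 := by ring
    _ ≤ n := by linarith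
end
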